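/- arXiv:1111.7109 — 3 statements merged into one kernel-verified Lean document; each statement's English description precedes it below -/
import Mathlib

section
/- Let 𝒢 be a closed subgroup of Sym(P) containing every permutation f of P satisfying (a ⊥ b ⟺ f(a) ⊥ f(b) for all a, b ∈ P), and suppose 𝒢 contains some permutation not of this form. Then 𝒢 contains every rotation of P. -/
variable {P : Type} [PartialOrder P]

/-- `a` and `b` are incomparable elements of the partial order `P`. -/
def Perp (a b : P) : Prop := ¬ a ≤ b ∧ ¬ b ≤ a

/-- `f` is an order-automorphism of `P`. -/
def IsOrderAuto (f : Equiv.Perm P) : Prop := ∀ a b : P, f a ≤ f b ↔ a ≤ b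

/-- `f` is an anti-automorphism of `P`. -/
def IsAntiAuto (f : Equiv.Perm P) : Prop := ∀ a b : P, f a ≤ f b ↔ b ≤ a

/-- Every finite partial order embeds into `P` (universality). -/
def IsUniversal (P : Type) [PartialOrder P] : Prop :=
  ∀ (Q : Type) [PartialOrder Q] [Fintype Q], Nonempty (Q ↪o P)

/-- Every order-isomorphism between two finite subsets of `P` extends to an
order-automorphism of `P` (homogeneity). -/
def IsHomogeneous (P : Type) [PartialOrder P] : Prop :=
  ∀ (S T : Finset P) (e : (S : Set P) ≃o (T : Set P)),
    ∃ g : P ≃o P, ∀ x : (S : Set P), g ↑x = ↑(e x)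

/-- A subgroup of `Sym(P)` is closed iff it contains every permutation that agrees
with one of its members on each finite subset of `P`. -/
def IsClosedSubgroup (G : Subgroup (Equiv.Perm P)) : Prop :=
  ∀ f : Equiv.Perm P,
    (∀ S : Finset P, ∃ g ∈ G, ∀ x ∈ S, (g : Equiv.Perm P) x = f x) → f ∈ G

/-- `h` is an order-automorphism of `P` fixing each of the constants `c i`. -/
def FixingAuto (n : ℕ) (c : Fin n → P) (h : Equiv.Perm P) : Prop :=
  IsOrderAuto h ∧ ∀ i : Fin n, h (c i) = c i

/-- `X` is an orbit of `(P, c₁, …, cₙ)`, i.e. an orbit of the action on `P` of the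
group of automorphisms of `P` fixing each `c i`. -/
def IsOrbit (n : ℕ) (c : Fin n → P) (X : Set P) : Prop :=
  ∃ x : P, X = {y | ∃ h : Equiv.Perm P, FixingAuto n c h ∧ h x = y}

/-- `g` is canonical as a function from `(P, c₁, …, cₙ)` to `P`. -/
def Canonical (n : ℕ) (c : Fin n → P) (g : P → P) : Prop :=
  ∀ (m : ℕ) (a b : Fin m → P),
    (∃ h : Equiv.Perm P, FixingAuto n c h ∧ ∀ j : Fin m, h (a j) = b j) →
    ∃ h' : Equiv.Perm P, IsOrderAuto h' ∧ ∀ j : Fin m, h' (g (a j)) = g (b j)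

/-- `g` is M-generated by the subgroup `G` of `Sym(P)`: on every finite subset of `P`
it agrees with some member of `G`. -/
def MGen (G : Subgroup (Equiv.Perm P)) (g : P → P) : Prop :=
  ∀ S : Finset P, ∃ h ∈ G, ∀ x ∈ S, (h : Equiv.Perm P) x = g x

/-- `g` behaves like `id` on `X`. -/
def BehavesLikeId (g : P → P) (X : Set P) : Prop :=
  ∀ x ∈ X, ∀ x' ∈ X, (x < x' → g x < g x') ∧ (Perp x x' → Perp (g x) (g x'))

/-- `g` behaves like `↕` on `X`. -/
def BehavesLikeRev (g : P → P) (X : Set P) : Prop :=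
  ∀ x ∈ X, ∀ x' ∈ X, (x < x' → g x' < g x) ∧ (Perp x x' → Perp (g x) (g x'))

/-- `g` behaves like `id` between `X` and `Y`. -/
def BehavesLikeIdBetween (g : P → P) (X Y : Set P) : Prop :=
  ∀ x ∈ X, ∀ y ∈ Y,
    (x < y → g x < g y) ∧ (y < x → g y < g x) ∧ (Perp x y → Perp (g x) (g y))

/-- `X ≤ Y` for subsets: some element of `X` lies below some element of `Y`. -/
def SetLE (X Y : Set P) : Prop := ∃ x ∈ X, ∃ y ∈ Y, x ≤ y

/-- `X < Y` for subsets: every element of `X` lies strictly below every element of `Y`. -/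
def SetLT (X Y : Set P) : Prop := ∀ x ∈ X, ∀ y ∈ Y, x < y

/-- The relation `X ÷ Y`. -/
def SetDiv (X Y : Set P) : Prop :=
  (SetLE X Y ∧ ¬ SetLE Y X ∧ ¬ SetLT X Y) ∨ (SetLE Y X ∧ ¬ SetLE X Y ∧ ¬ SetLT Y X)

/-- `f` is a rotation of `P`. -/
def IsRotation (f : Equiv.Perm P) : Prop :=
  ∃ X Y Z : Set P,
    (∀ p : P, p ∈ X ∨ p ∈ Y ∨ p ∈ Z) ∧
    Disjoint X Y ∧ Disjoint X Z ∧ Disjoint Y Z ∧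
    IsLowerSet X ∧ IsUpperSet Z ∧
    (∀ x ∈ X, ∀ z ∈ Z, x < z) ∧
    BehavesLikeId (⇑f) X ∧ BehavesLikeId (⇑f) Y ∧ BehavesLikeId (⇑f) Z ∧
    (∀ x ∈ X, ∀ z ∈ Z, f z < f x) ∧
    (∀ x ∈ X, ∀ y ∈ Y, (f y < f x ↔ Perp x y) ∧ (Perp (f x) (f y) ↔ x < y)) ∧
    (∀ y ∈ Y, ∀ z ∈ Z, (f z < f y ↔ Perp y z) ∧ (Perp (f y) (f z) ↔ y < z))

/-- The ternary relation `Cyc`. -/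
def Cyc (a b c : P) : Prop :=
  (a < b ∧ b < c) ∨ (b < c ∧ c < a) ∨ (c < a ∧ a < b) ∨
  (a < b ∧ Perp c a ∧ Perp c b) ∨ (b < c ∧ Perp a b ∧ Perp a c) ∨
  (c < a ∧ Perp b a ∧ Perp b c)

/-- The ternary relation `Cyc'`, the dual of `Cyc`. -/
def Cyc' (a b c : P) : Prop := Cyc c b a

/-- The ternary relation `Pari`. -/
def Pari (a b c : P) : Prop :=
  (Perp a b ∧ Perp b c ∧ Perp a c) ∨
  (a < b ∧ a < c ∧ Perp b c) ∨ (b < a ∧ b < c ∧ Perp a c) ∨ (c < a ∧ c < b ∧ Perp a b) ∨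
  (b < a ∧ c < a ∧ Perp b c) ∨ (a < b ∧ c < b ∧ Perp a c) ∨ (a < c ∧ b < c ∧ Perp a b)

/-- `f` preserves the ternary relation `R`. -/
def Preserves3 (f : P → P) (R : P → P → P → Prop) : Prop :=
  ∀ a b c : P, R a b c ↔ R (f a) (f b) (f c)

/-- A finite set of vertices in which the color of a pair depends only on its smaller element. -/
theorem exists_end_homogeneous {α κ : Type*} [LinearOrder α] [Fintype κ] (L : ℕ) :
    ∃ N, ∀ (χ : α → α → κ) (S : Finset α), N ≤ S.card →
      ∃ T ⊆ S, T.card = L ∧ ∃ c : α → κ, ∀ a ∈ T, ∀ b ∈ T, a < b → χ a b = c a := by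
  classical
  induction L with
  | zero =>
    refine ⟨1, fun χ S hS => ⟨∅, by simp, by simp, ?_⟩⟩
    obtain ⟨a, -⟩ := Finset.card_pos.mp hS
    exact ⟨fun b => χ b b, by simp⟩
  | succ L ih =>
    obtain ⟨N, hN⟩ := ih
    refine ⟨Fintype.card κ * N + 1, fun χ S hS => ?_⟩
    have hne : S.Nonempty := Finset.card_pos.mp (by omega)
    set a := S.min' hne with ha
    have haS : a ∈ S := S.min'_mem hne
    have hlt : ∀ b ∈ S.erase a, a < b := fun b hb =>
      lt_of_le_of_ne (S.min'_le b (Finset.mem_of_mem_erase hb)) (Finset.ne_of_mem_erase hb).symm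
    have hκ : (Finset.univ : Finset κ).Nonempty := ⟨χ a a, Finset.mem_univ _⟩
    obtain ⟨k, -, hk⟩ := Finset.exists_le_card_fiber_of_mul_le_card_of_maps_to
      (s := S.erase a) (t := (Finset.univ : Finset κ)) (f := χ a) (n := N)
      (fun _ _ => Finset.mem_univ _) hκ
      (by rw [Finset.card_erase_of_mem haS, Finset.card_univ]; omega)
    obtain ⟨T, hTS, hT, c, hc⟩ := hN χ _ hk
    have hTa : ∀ b ∈ T, b ∈ S.erase a ∧ χ a b = k := fun b hb => by
      simpa using hTS hb
    have haT : a ∉ T := fun h => by simpa using (hTa a h).1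
    refine ⟨insert a T, ?_, by simp [haT, hT], Function.update c a k, ?_⟩
    · intro b hb
      rcases Finset.mem_insert.mp hb with rfl | hb
      · exact haS
      · exact Finset.mem_of_mem_erase (hTa b hb).1
    · intro x hx y hy hxy
      rcases Finset.mem_insert.mp hx with rfl | hx <;> rcases Finset.mem_insert.mp hy with rfl | hy
      · exact absurd hxy (lt_irrefl _)
      · simpa using (hTa y hy).2
      · exact absurd hxy (hlt x (hTa x hx).1).not_gt
      · rw [Function.update_of_ne (by rintro rfl; exact haT hx)]
        exact hc x hx y hy hxy

/-- Ramsey's theorem for pairs. -/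
theorem exists_homogeneous_pairs (κ : Type*) [Finite κ] (n : ℕ) :
    ∃ N, ∀ χ : Fin N → Fin N → κ, ∃ h : Fin n → Fin N, StrictMono h ∧
      ∃ k, ∀ a b, a < b → χ (h a) (h b) = k := by
  classical
  have := Fintype.ofFinite κ
  have key : ∃ N, ∀ χ : ℕ → ℕ → κ, ∃ h : Fin n → ℕ, StrictMono h ∧ (∀ i, h i < N) ∧
      ∃ k, ∀ a b, a < b → χ (h a) (h b) = k := by
    obtain ⟨N, hN⟩ := exists_end_homogeneous (α := ℕ) (κ := κ) (Fintype.card κ * n)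
    refine ⟨N, fun χ => ?_⟩
    obtain ⟨T, hTS, hT, c, hc⟩ := hN χ (Finset.range N) (by simp)
    have hκ : (Finset.univ : Finset κ).Nonempty := ⟨χ 0 0, Finset.mem_univ _⟩
    obtain ⟨k, -, hk⟩ := Finset.exists_le_card_fiber_of_mul_le_card_of_maps_to
      (s := T) (t := (Finset.univ : Finset κ)) (f := c) (n := n)
      (fun _ _ => Finset.mem_univ _) hκ (by rw [hT, Finset.card_univ])
    obtain ⟨U, hU, hUn⟩ := Finset.exists_subset_card_eq hk
    have hmem : ∀ i, U.orderEmbOfFin hUn i ∈ T ∧ c (U.orderEmbOfFin hUn i) = k := fun i => by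
      simpa using hU (U.orderEmbOfFin_mem hUn i)
    refine ⟨U.orderEmbOfFin hUn, (U.orderEmbOfFin hUn).strictMono,
      fun i => by simpa using hTS (hmem i).1, k, fun a b hab => ?_⟩
    rw [hc _ (hmem a).1 _ (hmem b).1 ((U.orderEmbOfFin hUn).strictMono hab), (hmem a).2]
  obtain ⟨N, hN⟩ := key
  refine ⟨N + 1, fun χ => ?_⟩
  obtain ⟨h, hh, hlt, k, hk⟩ := hN fun a b => χ (Fin.ofNat _ a) (Fin.ofNat _ b)
  have hval : ∀ i, (Fin.ofNat (N + 1) (h i) : ℕ) = h i := fun i =>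
    Nat.mod_eq_of_lt ((hlt i).trans (Nat.lt_succ_self N))
  refine ⟨fun i => Fin.ofNat _ (h i), fun a b hab => ?_, k, hk⟩
  rw [Fin.lt_def, hval, hval]
  exact hh hab

/-- The product Ramsey theorem for pairs. -/
theorem exists_homogeneous_grid (e n : ℕ) (κ : Type) [Finite κ] :
    ∃ N, ∀ χ : (Fin e → Fin N) → (Fin e → Fin N) → κ, ∃ h : Fin e → Fin n → Fin N,
      (∀ i, StrictMono (h i)) ∧ ∃ k, ∀ u v : Fin e → Fin n, (∀ i, u i < v i) →
        χ (fun i => h i (u i)) (fun i => h i (v i)) = k := by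
  induction e with
  | zero =>
    refine ⟨0, fun χ => ⟨fun i => i.elim0, fun i => i.elim0, χ Fin.elim0 Fin.elim0, ?_⟩⟩
    intro u v _
    congr <;> exact Subsingleton.elim _ _
  | succ e ih =>
    obtain ⟨N₁, hN₁⟩ := ih
    obtain ⟨N₂, hN₂⟩ :=
      exists_homogeneous_pairs ((Fin e → Fin N₁) → (Fin e → Fin N₁) → κ) n
    refine ⟨max N₁ N₂, fun χ => ?_⟩
    let i₁ : Fin N₁ → Fin (max N₁ N₂) := Fin.castLE (le_max_left _ _)
    let i₂ : Fin N₂ → Fin (max N₁ N₂) := Fin.castLE (le_max_right _ _)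
    obtain ⟨h₂, hh₂, ψ, hψ⟩ := hN₂ fun a b u v =>
      χ (Fin.cons (i₂ a) fun i => i₁ (u i)) (Fin.cons (i₂ b) fun i => i₁ (v i))
    obtain ⟨h₁, hh₁, k, hk⟩ := hN₁ ψ
    refine ⟨Fin.cons (fun a => i₂ (h₂ a)) fun i a => i₁ (h₁ i a), ?_, k, fun u v huv => ?_⟩
    · intro i
      refine Fin.cases ?_ (fun i => ?_) i
      · exact fun a b hab => hh₂ hab
      · exact fun a b hab => hh₁ i hab
    · have h := congrFun (congrFun (hψ _ _ (huv 0)) fun i => h₁ i (u i.succ))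
        fun i => h₁ i (v i.succ)
      rw [hk (fun i => u i.succ) (fun i => v i.succ) fun i => huv i.succ] at h
      rw [← h]
      congr 1 <;> funext i <;> refine Fin.cases ?_ (fun i => ?_) i <;> rfl

/-- The sign vector that is positive except possibly at the coordinate `j`. -/
def flipSign {E : Type} [DecidableEq E] (j : E) : E → Bool := fun i => decide (i ≠ j)

theorem zmod_three_cases (x : ZMod 3) : x = 0 ∨ x = 1 ∨ x = -1 := by
  revert x; decide

theorem flipSign_ne {E : Type} [DecidableEq E] (j : E) : flipSign j ≠ fun _ => true := fun h => by
  simpa [flipSign] using congrFun h j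

theorem flipSign_ne_false {E : Type} [DecidableEq E] {i j : E} (hij : i ≠ j) :
    flipSign j ≠ fun _ => false := fun h => by
  simpa [flipSign, hij] using congrFun h i

/-- A color pattern on one grid: `r σ` is the relation between the images of two points whose
coordinatewise comparison is `σ`. If it distinguishes `+` from each `flipSign j`, then it is the
coordinatewise order or its reverse. -/
theorem grid_pattern_eq {E : Type} [DecidableEq E] (r : (E → Bool) → ZMod 3)
    (anti : ∀ σ, r (fun i => !σ i) = -r σ)
    (trans : ∀ σ τ υ, r σ = 1 → r τ = 1 → (∀ i, σ i = τ i → υ i = σ i) → r υ = 1)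
    (ne : ∀ j, r (fun _ => true) ≠ r (flipSign j))
    (h3 : ∃ a b c : E, a ≠ b ∧ a ≠ c ∧ b ≠ c) :
    ∃ s : ZMod 3, (s = 1 ∨ s = -1) ∧ r (fun _ => true) = s ∧
      ∀ σ, σ ≠ (fun _ => true) → σ ≠ (fun _ => false) → r σ = 0 := by
  have pos : ∀ r : (E → Bool) → ZMod 3, (∀ σ, r (fun i => !σ i) = -r σ) →
      (∀ σ τ υ, r σ = 1 → r τ = 1 → (∀ i, σ i = τ i → υ i = σ i) → r υ = 1) →
      (∀ j, r (fun _ => true) ≠ r (flipSign j)) → r (fun _ => true) = 1 →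
      ∀ σ, σ ≠ (fun _ => true) → σ ≠ (fun _ => false) → r σ = 0 := by
    intro r anti trans ne h1
    have key : ∀ σ, σ ≠ (fun _ => true) → r σ ≠ 1 := by
      intro σ hσ hr
      obtain ⟨j, hj⟩ : ∃ j, σ j = false := by
        by_contra! h
        exact hσ (funext fun i => by simpa using h i)
      refine ne j (h1.trans (trans _ σ _ h1 hr fun i hi => ?_).symm)
      have : i ≠ j := by rintro rfl; simp [hj] at hi
      simp [flipSign, this]
    intro σ h₁ h₂
    have h3 := key σ h₁
    have h4 := key (fun i => !σ i) fun h => h₂ (funext fun i => by simpa using congrFun h i)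
    rw [anti] at h4
    rcases zmod_three_cases (r σ) with h | h | h
    · exact h
    · exact absurd h h3
    · exact absurd (by rw [h]; decide) h4
  have anti' : ∀ σ, -r (fun i => !σ i) = - -r σ := fun σ => by rw [anti]
  have trans' : ∀ σ τ υ, -r σ = 1 → -r τ = 1 → (∀ i, σ i = τ i → υ i = σ i) → -r υ = 1 := by
    intro σ τ υ h₁ h₂ h
    rw [← anti] at h₁ h₂ ⊢
    refine trans _ _ _ h₁ h₂ fun i hi => ?_
    rw [h i (by simpa using hi)]
  have two : ∀ r : (E → Bool) → ZMod 3,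
      (∀ σ τ υ, r σ = 1 → r τ = 1 → (∀ i, σ i = τ i → υ i = σ i) → r υ = 1) →
      ∀ a b, a ≠ b → r (flipSign a) = 1 → r (flipSign b) = 1 → r (fun _ => true) = 1 := by
    intro r trans a b hab ha hb
    refine trans _ _ _ ha hb fun i hi => ?_
    by_contra h
    have h1 : i = a := by simpa [flipSign] using h
    have h2 : i = b := by simpa [flipSign, h1] using hi
    exact hab (h1.symm.trans h2)
  rcases zmod_three_cases (r fun _ => true) with h | h | h
  · exfalso
    have nz : ∀ j, r (flipSign j) = 1 ∨ r (flipSign j) = -1 := fun j =>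
      (zmod_three_cases _).resolve_left fun h' => ne j (h.trans h'.symm)
    have t1 : ∀ a b, a ≠ b → ¬(r (flipSign a) = 1 ∧ r (flipSign b) = 1) := fun a b hab h' =>
      absurd (h.symm.trans (two r trans a b hab h'.1 h'.2)) (by decide)
    have t2 : ∀ a b, a ≠ b → ¬(r (flipSign a) = -1 ∧ r (flipSign b) = -1) := fun a b hab h' =>
      absurd (two (fun σ => -r σ) trans' a b hab (by simp [h'.1]) (by simp [h'.2]))
        (by simp only [h]; decide)
    obtain ⟨a, b, c, hab, hac, hbc⟩ := h3
    have := t1 a b hab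
    have := t1 a c hac
    have := t1 b c hbc
    have := t2 a b hab
    have := t2 a c hac
    have := t2 b c hbc
    have := nz a
    have := nz b
    have := nz c
    tauto
  · exact ⟨1, Or.inl rfl, h, pos r anti trans ne h⟩
  · refine ⟨-1, Or.inr rfl, h, fun σ h₁ h₂ => ?_⟩
    exact neg_eq_zero.mp (pos (fun σ => -r σ) anti' trans'
      (fun j h' => ne j (neg_injective h')) (by simp [h]) σ h₁ h₂)

/-- `ρ` describes the relations between points of several grids in some partial order: `ρ k k' σ`
is the relation between a point of the grid `k` and a point of the grid `k'` whose coordinatewise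
comparison is `σ`. -/
structure IsGridPattern {K E : Type} (ρ : K → K → (E → Bool) → ZMod 3) : Prop where
  anti : ∀ k k' σ, ρ k' k (fun i => !σ i) = -ρ k k' σ
  trans : ∀ k k' k'' σ τ υ, ρ k k' σ = 1 → ρ k' k'' τ = 1 → (∀ i, σ i = τ i → υ i = σ i) →
    ρ k k'' υ = 1

/-- `ν k` is the relation between one fixed point and all points of the grid `k`. -/
structure IsPointPattern {K E : Type} (ρ : K → K → (E → Bool) → ZMod 3) (ν : K → ZMod 3) :
    Prop where
  up : ∀ k k' σ, ν k = 1 → ρ k k' σ = 1 → ν k' = 1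
  down : ∀ k k' σ, ν k = -1 → ρ k' k σ = 1 → ν k' = -1
  between : ∀ k k' σ, ν k = -1 → ν k' = 1 → ρ k k' σ = 1

theorem IsGridPattern.neg {K E : Type} {ρ : K → K → (E → Bool) → ZMod 3}
    (h : IsGridPattern ρ) : IsGridPattern fun k k' σ => -ρ k k' σ where
  anti k k' σ := by rw [h.anti]
  trans k k' k'' σ τ υ h₁ h₂ hυ := by
    rw [← h.anti] at h₁ h₂ ⊢
    refine h.trans _ _ _ _ _ _ h₂ h₁ fun i hi => ?_
    rw [hυ i (by simpa using hi.symm)]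
    exact hi.symm

theorem IsPointPattern.neg {K E : Type} {ρ : K → K → (E → Bool) → ZMod 3} {ν : K → ZMod 3}
    (hρ : IsGridPattern ρ) (h : IsPointPattern ρ ν) :
    IsPointPattern (fun k k' σ => -ρ k k' σ) fun k => -ν k where
  up k k' σ h₁ h₂ := by
    rw [← hρ.anti] at h₂
    rw [h.down k k' _ (by rw [← h₁, neg_neg]) h₂, neg_neg]
  down k k' σ h₁ h₂ := by
    rw [← hρ.anti] at h₂
    rw [h.up k k' _ (neg_injective h₁) h₂]
  between k k' σ h₁ h₂ := by
    rw [← hρ.anti]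
    exact h.between k' k _ (by rw [← h₂, neg_neg]) (neg_injective h₁)

/-- If the grid `k` lies below the grid `k'`, each of them is mapped to the coordinatewise order
or its reverse, and the pattern is not one of those excluded in the hypotheses, then the two grids
are mapped in the same direction and the relation between them is kept. -/
theorem IsGridPattern.eq_between {K E : Type} [DecidableEq E] {ρ : K → K → (E → Bool) → ZMod 3}
    (hρ : IsGridPattern ρ) {k k' : K} {s s' : ZMod 3} (hs : s = 1 ∨ s = -1)
    (hs' : s' = 1 ∨ s' = -1)
    (hk : ρ k k (fun _ => true) = s)
    (hk0 : ∀ σ, σ ≠ (fun _ => true) → σ ≠ (fun _ => false) → ρ k k σ = 0)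
    (hk' : ρ k' k' (fun _ => true) = s')
    (ne : ∀ j, ρ k k' (fun _ => true) ≠ ρ k k' (flipSign j))
    (drop : ∀ j, ¬(ρ k' k (fun _ => true) = ρ k k (fun _ => true) ∧
      ρ k' k (flipSign j) = ρ k k (flipSign j)))
    (rot : ∀ j, ¬(ρ k k' (fun _ => true) = 0 ∧ ρ k k' (flipSign j) = -s'))
    (h2 : ∃ a b : E, a ≠ b) :
    s = s' ∧ ρ k k' (fun _ => true) = s' ∧ ∀ σ, σ ≠ (fun _ => true) → ρ k k' σ = 0 := by
  wlog h1 : s' = 1 generalizing ρ s s'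
  · have hs1 : s' = -1 := hs'.resolve_left h1
    obtain ⟨g₁, g₂, g₃⟩ := this hρ.neg (s := -s) (s' := -s')
      (by rcases hs with rfl | rfl <;> simp) (by simp [hs1]) (by simp [hk])
      (fun σ h h' => by simp [hk0 σ h h']) (by simp [hk'])
      (fun j h => ne j (neg_injective h))
      (fun j h => drop j ⟨neg_injective h.1, neg_injective h.2⟩)
      (fun j h => rot j ⟨neg_eq_zero.mp h.1, neg_injective h.2⟩) (by simp [hs1])
    exact ⟨neg_injective g₁, neg_injective g₂, fun σ h => neg_eq_zero.mp (g₃ σ h)⟩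
  subst h1
  have flip_le : ∀ (σ : E → Bool) j, σ j = false → ∀ i, σ i = true → flipSign j i = true := by
    intro σ j hj i hi
    have : i ≠ j := by rintro rfl; simp [hj] at hi
    simp [flipSign, this]
  have exj : ∀ σ : E → Bool, σ ≠ (fun _ => true) → ∃ j, σ j = false := by
    intro σ hσ
    by_contra! h
    exact hσ (funext fun i => by simpa using h i)
  have up : ∀ σ υ, ρ k k' σ = 1 → (∀ i, σ i = true → υ i = true) → ρ k k' υ = 1 :=
    fun σ υ h hυ => hρ.trans _ _ _ _ _ _ h hk' fun i hi => by rw [hi]; exact hυ i hi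
  obtain ⟨j₀, j₁, hj⟩ := h2
  rcases zmod_three_cases (ρ k k' fun _ => true) with h | h | h
  · exfalso
    rcases zmod_three_cases (ρ k k' (flipSign j₀)) with h' | h' | h'
    · exact ne j₀ (h.trans h'.symm)
    · exact absurd (h.symm.trans (up _ _ h' fun _ _ => rfl)) (by decide)
    · exact rot j₀ ⟨h, h'⟩
  · have hs1 : s = 1 := by
      rcases hs with hs | hs
      · exact hs
      · exfalso
        have hm : ρ k k (fun _ => false) = 1 := by
          have := hρ.anti k k fun _ => true
          rw [hk, hs, neg_neg] at this
          exact this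
        exact ne j₀ (h.trans (hρ.trans _ _ _ _ _ _ hm h fun i hi => by simp at hi).symm)
    subst hs1
    have n1 : ∀ σ, σ ≠ (fun _ => true) → ρ k k' σ ≠ 1 := by
      intro σ hσ h'
      obtain ⟨j, hj⟩ := exj σ hσ
      exact ne j (h.trans (up _ _ h' (flip_le σ j hj)).symm)
    have n2 : ∀ σ i₀, σ i₀ = true → ρ k k' σ ≠ -1 := by
      intro σ i₀ hi₀ h'
      have h2 : ρ k' k (fun i => !σ i) = 1 := by rw [hρ.anti, h', neg_neg]
      have h3 : ρ k k (flipSign i₀) = 1 := hρ.trans _ _ _ _ _ _ h h2 fun i hi => by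
        have : i ≠ i₀ := by rintro rfl; simp [hi₀] at hi
        simp [flipSign, this]
      rw [hk0 _ (flipSign_ne _) fun h4 => ?_] at h3
      · exact absurd h3 (by decide)
      · have g₀ := congrFun h4 j₀
        have g₁ := congrFun h4 j₁
        simp only [flipSign, decide_eq_false_iff_not, not_not] at g₀ g₁
        exact hj (g₀.trans g₁.symm)
    have n3 : ∀ σ i₀, σ i₀ = true → σ ≠ (fun _ => true) → ρ k k' σ = 0 := fun σ i₀ h₁ h₂ => by
      rcases zmod_three_cases (ρ k k' σ) with h' | h' | h'
      exacts [h', absurd h' (n1 σ h₂), absurd h' (n2 σ i₀ h₁)]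
    refine ⟨rfl, h, fun σ hσ => ?_⟩
    by_cases hσ0 : ∃ i₀, σ i₀ = true
    · obtain ⟨i₀, hi₀⟩ := hσ0
      exact n3 σ i₀ hi₀ hσ
    · have hσf : σ = fun _ => false := funext fun i => by
        by_contra hi
        exact hσ0 ⟨i, by simpa using hi⟩
      rcases zmod_three_cases (ρ k k' σ) with h' | h' | h'
      · exact h'
      · exact absurd h' (n1 σ hσ)
      · exfalso
        have hb : ρ k' k (fun _ => true) = 1 := by
          have := hρ.anti k k' σ
          rw [h', neg_neg, hσf] at this
          exact this
        refine drop j₀ ⟨hb.trans hk.symm, ?_⟩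
        rw [hk0 _ (flipSign_ne _) fun h4 => ?_]
        · have := hρ.anti k' k (flipSign j₀)
          rw [n3 _ j₀ (by simp [flipSign]) fun h4 => ?_] at this
          · exact neg_eq_zero.mp this.symm
          · have := congrFun h4 j₁
            simp [flipSign, hj.symm] at this
        · have := congrFun h4 j₁
          simp [flipSign, hj.symm] at this
  · exfalso
    have hm : ρ k' k (fun _ => false) = 1 := by
      have := hρ.anti k k' fun _ => true
      rw [h, neg_neg] at this
      exact this
    have h2 : ρ k' k (fun i => !flipSign j₀ i) = 1 :=
      hρ.trans _ _ _ _ _ _ hk' hm fun i hi => by simp at hi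
    rw [hρ.anti, neg_eq_iff_eq_neg] at h2
    exact ne j₀ (h.trans h2.symm)

theorem IsPointPattern.eq_of_ne {K E : Type} {ρ : K → K → (E → Bool) → ZMod 3} {ν : K → ZMod 3}
    (hρ : IsGridPattern ρ) (hν : IsPointPattern ρ ν) {k k' : K} {s : ZMod 3}
    (hs : s = 1 ∨ s = -1) {σ τ : E → Bool} (hσ : ρ k k' σ = s) (hτ : ρ k k' τ = 0)
    (ne : ν k ≠ ν k') (rot : ¬(ν k' = 0 ∧ ν k = -s)) : ν k = 0 ∧ ν k' = s := by
  wlog h1 : s = 1 generalizing ρ ν s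
  · have hs1 : s = -1 := hs.resolve_left h1
    obtain ⟨g₁, g₂⟩ := this hρ.neg (hν.neg hρ) (s := -s) (by simp [hs1]) (by simp [hσ])
      (by simp [hτ]) (fun h => ne (neg_injective h))
      (fun h => rot ⟨neg_eq_zero.mp h.1, neg_injective h.2⟩) (by simp [hs1])
    exact ⟨neg_eq_zero.mp g₁, neg_injective g₂⟩
  subst h1
  have h10 : (1 : ZMod 3) ≠ 0 := by decide
  have h11 : (1 : ZMod 3) ≠ -1 := by decide
  have h01 : (0 : ZMod 3) ≠ -1 := by decide
  rcases zmod_three_cases (ν k) with h | h | h <;> rcases zmod_three_cases (ν k') with h' | h' | h'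
  · exact absurd (h.trans h'.symm) ne
  · exact ⟨h, h'⟩
  · exact absurd (h.symm.trans (hν.down _ _ _ h' hσ)) h01
  · exact absurd ((hν.up _ _ _ h hσ).symm.trans h') h10
  · exact absurd (h.trans h'.symm) ne
  · exact absurd ((hν.up _ _ _ h hσ).symm.trans h') h11
  · exact absurd ⟨h', h⟩ rot
  · exact absurd ((hν.between _ _ τ h h').symm.trans hτ) h10
  · exact absurd (h.trans h'.symm) ne

open Classical in
/-- The relation between `a` and `b`: `1` for `a < b`, `-1` for `b < a`, and `0` otherwise. -/
noncomputable def rel (a b : P) : ZMod 3 := if a < b then 1 else if b < a then -1 else 0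

theorem rel_eq_one {a b : P} : rel a b = 1 ↔ a < b := by
  unfold rel
  split_ifs with h h'
  · simp [h]
  · simpa [h] using (by decide : (-1 : ZMod 3) ≠ 1)
  · simp [h]

theorem rel_swap (a b : P) : rel b a = -rel a b := by
  unfold rel
  split_ifs with h h'
  · exact absurd h' h.not_gt
  · simp
  · rfl
  · simp

theorem rel_eq_neg_one {a b : P} : rel a b = -1 ↔ b < a := by
  rw [← rel_eq_one, rel_swap a b, neg_eq_iff_eq_neg]

theorem rel_self (a : P) : rel a a = 0 := by simp [rel]

theorem rel_eq_zero {a b : P} : rel a b = 0 ↔ ¬a < b ∧ ¬b < a := by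
  rw [← rel_eq_one, ← rel_eq_neg_one]
  rcases zmod_three_cases (rel a b) with h | h | h <;> rw [h] <;> decide

theorem perp_iff_rel {a b : P} : Perp a b ↔ a ≠ b ∧ rel a b = 0 := by
  rw [rel_eq_zero]
  constructor
  · rintro ⟨h₁, h₂⟩
    exact ⟨fun h => h₁ h.le, fun h => h₁ h.le, fun h => h₂ h.le⟩
  · rintro ⟨h₀, h₁, h₂⟩
    exact ⟨fun h => h₁ (lt_of_le_of_ne h h₀), fun h => h₂ (lt_of_le_of_ne h h₀.symm)⟩

/-- Some member of `G` maps the tuple `a` to the tuple `b`. -/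
def Sim {α : Type} (G : Subgroup (Equiv.Perm α)) {W : Type} (a b : W → α) : Prop :=
  ∃ g ∈ G, ∀ w, (g : Equiv.Perm α) (a w) = b w

theorem Sim.symm {α : Type} {G : Subgroup (Equiv.Perm α)} {W : Type} {a b : W → α} (h : Sim G a b) :
    Sim G b a := by
  obtain ⟨g, hg, h⟩ := h
  exact ⟨g⁻¹, G.inv_mem hg, fun w => by rw [← h w]; simp⟩

theorem Sim.trans {α : Type} {G : Subgroup (Equiv.Perm α)} {W : Type} {a b c : W → α} (h : Sim G a b)
    (h' : Sim G b c) : Sim G a c := by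
  obtain ⟨g, hg, h⟩ := h
  obtain ⟨g', hg', h'⟩ := h'
  exact ⟨g' * g, G.mul_mem hg' hg, fun w => by simp [h w, h' w]⟩

theorem sim_apply {α : Type} {G : Subgroup (Equiv.Perm α)} {W : Type} {f : Equiv.Perm α} (hf : f ∈ G)
    (a : W → α) : Sim G a fun w => f (a w) := ⟨f, hf, fun _ => rfl⟩

theorem Sim.injective {α : Type} {G : Subgroup (Equiv.Perm α)} {W : Type} {a b : W → α} (h : Sim G a b)
    (ha : Function.Injective a) : Function.Injective b := by
  obtain ⟨g, -, h⟩ := h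
  intro w w' hw
  rw [← h w, ← h w'] at hw
  exact ha (g.injective hw)

theorem IsHomogeneous.exists_orderIso (hH : IsHomogeneous P) {W : Type} [Finite W] {a b : W → P}
    (ha : Function.Injective a) (hb : Function.Injective b)
    (hab : ∀ w w', rel (a w) (a w') = rel (b w) (b w')) : ∃ g : P ≃o P, ∀ w, g (a w) = b w := by
  have hS : ((Set.finite_range a).toFinset : Set P) = Set.range a := Set.Finite.coe_toFinset _
  have hT : ((Set.finite_range b).toFinset : Set P) = Set.range b := Set.Finite.coe_toFinset _
  let e : W ≃ ((Set.finite_range a).toFinset : Set P) :=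
    (Equiv.ofInjective a ha).trans (Equiv.setCongr hS.symm)
  let e' : W ≃ ((Set.finite_range b).toFinset : Set P) :=
    (Equiv.ofInjective b hb).trans (Equiv.setCongr hT.symm)
  have hle : ∀ w w', a w ≤ a w' ↔ b w ≤ b w' := fun w w' => by
    rw [le_iff_lt_or_eq, le_iff_lt_or_eq, ← rel_eq_one, ← rel_eq_one, hab, ha.eq_iff, hb.eq_iff]
  obtain ⟨g, hg⟩ := hH _ _
    { toEquiv := e.symm.trans e'
      map_rel_iff' := by
        intro x y
        obtain ⟨w, rfl⟩ := e.surjective x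
        obtain ⟨w', rfl⟩ := e.surjective y
        simp only [Equiv.trans_apply, Equiv.symm_apply_apply]
        exact (hle w w').symm }
  refine ⟨g, fun w => ?_⟩
  have h := hg (e w)
  have h' : ((e' (e.symm (e w)) : _) : P) = b w := by rw [e.symm_apply_apply]; rfl
  exact h.trans h'

/-- Tuples with the same order pattern are conjugate under `G`. -/
theorem sim_of_rel_eq (hH : IsHomogeneous P) {G : Subgroup (Equiv.Perm P)}
    (hR : ∀ f : Equiv.Perm P, (∀ a b : P, Perp a b ↔ Perp (f a) (f b)) → f ∈ G)
    {W : Type} [Finite W] {a b : W → P} (ha : Function.Injective a) (hb : Function.Injective b)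
    (hab : ∀ w w', rel (a w) (a w') = rel (b w) (b w')) : Sim G a b := by
  obtain ⟨g, hg⟩ := hH.exists_orderIso ha hb hab
  exact ⟨g.toEquiv, hR _ fun x y => by simp [Perp], hg⟩

/-- Two points together with copies of the grid `Fin e → Fin N`, one for each `k : Bool → Bool`. -/
inductive GridDomain (e N : ℕ) : Type
  | point (b : Bool)
  | grid (k : Bool → Bool) (u : Fin e → Fin N)

namespace GridDomain

variable {e N : ℕ}

instance : Finite (GridDomain e N) :=
  Finite.of_surjective
    (Sum.elim point fun p => grid p.1 p.2 : Bool ⊕ ((Bool → Bool) × (Fin e → Fin N)) → _) <| by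
    rintro (b | ⟨k, u⟩)
    exacts [⟨Sum.inl b, rfl⟩, ⟨Sum.inr (k, u), rfl⟩]

/-- The point `b` lies below the grids `k` with `k b = true`; points of the grids are compared
strictly coordinatewise. -/
def Lt : GridDomain e N → GridDomain e N → Prop
  | point b, grid k _ => k b = true
  | grid k u, grid k' v => k ≤ k' ∧ ∀ i, u i < v i
  | _, point _ => False

theorem isStrictOrder (he : 0 < e) : IsStrictOrder (GridDomain e N) Lt where
  irrefl := by
    rintro (b | ⟨k, u⟩) h
    · exact h
    · exact lt_irrefl _ (h.2 ⟨0, he⟩)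
  trans := by
    rintro (b | ⟨k, u⟩) (b' | ⟨k', v⟩) (b'' | ⟨k'', w⟩) h h'
    any_goals first | exact h.elim | exact h'.elim
    · have := h'.1 b
      rw [show k' b = true from h] at this
      exact top_le_iff.mp this
    · exact ⟨h.1.trans h'.1, fun i => (h.2 i).trans (h'.2 i)⟩

end GridDomain

/-- The points `x b` and the maps `F k` embed `GridDomain e N` into `P`. -/
structure IsGridEmbedding {e N : ℕ} (x : Bool → P) (F : (Bool → Bool) → (Fin e → Fin N) → P) :
    Prop where
  lt_iff : ∀ k k' u v, F k u < F k' v ↔ k ≤ k' ∧ ∀ i, u i < v i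
  rel_point : ∀ b k u, rel (x b) (F k u) = if k b then 1 else 0
  ne : ∀ b k u, x b ≠ F k u
  inj : ∀ k k' u v, F k u = F k' v → u = v

theorem exists_gridEmbedding (hU : IsUniversal P) (hH : IsHomogeneous P) {e : ℕ} (he : 0 < e)
    (N : ℕ) {x : Bool → P} (hx : Perp (x false) (x true)) :
    ∃ F : (Bool → Bool) → (Fin e → Fin N) → P, IsGridEmbedding x F := by
  have := GridDomain.isStrictOrder (N := N) he
  let _ : PartialOrder (GridDomain e N) := partialOrderOfSO GridDomain.Lt
  let _ : Fintype (GridDomain e N) := Fintype.ofFinite _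
  obtain ⟨ι⟩ := hU (GridDomain e N)
  have hι : ∀ p q : GridDomain e N, ι p < ι q ↔ GridDomain.Lt p q := fun p q => ι.lt_iff_lt
  have hx0 : ∀ b b', rel (x b) (x b') = 0 := by
    have h := (perp_iff_rel.mp hx).2
    have h' := rel_swap (x false) (x true)
    rw [h, neg_zero] at h'
    rintro (_ | _) (_ | _)
    exacts [rel_self _, h, h', rel_self _]
  have hxi : Function.Injective x := by
    have h := (perp_iff_rel.mp hx).1
    rintro (_ | _) (_ | _) hb
    exacts [rfl, absurd hb h, absurd hb.symm h, rfl]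
  obtain ⟨g, hg⟩ := hH.exists_orderIso (a := fun b => ι (.point b)) (b := x)
    (fun b b' hb => GridDomain.point.inj (ι.injective hb)) hxi fun b b' => by
      rw [hx0, rel_eq_zero, hι, hι]
      exact ⟨id, id⟩
  refine ⟨fun k u => g (ι (.grid k u)), fun k k' u v => ?_, fun b k u => ?_,
    fun b k u h => ?_, fun k k' u v h => ?_⟩
  · rw [g.lt_iff_lt, hι]
    exact Iff.rfl
  · rw [← hg b]
    split_ifs with h
    · rw [rel_eq_one, g.lt_iff_lt, hι]
      exact h
    · rw [rel_eq_zero, g.lt_iff_lt, g.lt_iff_lt, hι, hι]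
      exact ⟨h, id⟩
  · rw [← hg b] at h
    cases ι.injective (g.injective h)
  · exact (GridDomain.grid.inj (ι.injective (g.injective h))).2

/-- The coordinatewise comparison of `u` and `v`. -/
def compareSign {e N : ℕ} (u v : Fin e → Fin N) : Fin e → Bool := fun i => decide (u i < v i)

/-- A grid embedding on which `f` depends only on the coordinatewise comparisons. -/
structure IsCanonicalGrid {e N : ℕ} (f : P → P) (x : Bool → P)
    (F : (Bool → Bool) → (Fin e → Fin N) → P)
    (ρ : (Bool → Bool) → (Bool → Bool) → (Fin e → Bool) → ZMod 3)
    (ν : Bool → (Bool → Bool) → ZMod 3) : Prop extends IsGridEmbedding x F where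
  rel_grid : ∀ k k' u v, (∀ i, u i ≠ v i) →
    rel (f (F k u)) (f (F k' v)) = ρ k k' (compareSign u v)
  rel_point_image : ∀ b k u, rel (f (x b)) (f (F k u)) = ν b k

theorem exists_canonicalGrid (hU : IsUniversal P) (hH : IsHomogeneous P) {e : ℕ} (he : 0 < e)
    (n : ℕ) {x : Bool → P} (hx : Perp (x false) (x true)) (f : P → P) :
    ∃ (F : (Bool → Bool) → (Fin e → Fin n) → P)
      (ρ : (Bool → Bool) → (Bool → Bool) → (Fin e → Bool) → ZMod 3)
      (ν : Bool → (Bool → Bool) → ZMod 3), IsCanonicalGrid f x F ρ ν := by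
  obtain ⟨N, hN⟩ := exists_homogeneous_grid e (n + 1)
    (((Fin e → Bool) → (Bool → Bool) → (Bool → Bool) → ZMod 3) × (Bool → (Bool → Bool) → ZMod 3))
  obtain ⟨F, hF⟩ := exists_gridEmbedding hU hH he N hx
  obtain ⟨h, hh, ⟨ρ, ν⟩, hρ⟩ := hN fun u v =>
    (fun σ k k' => rel (f (F k fun i => if σ i then u i else v i))
      (f (F k' fun i => if σ i then v i else u i)), fun b k => rel (f (x b)) (f (F k u)))
  refine ⟨fun k u => F k fun i => h i (u i).castSucc, fun k k' σ => ρ σ k k', ν,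
    ⟨fun k k' u v => ?_, fun b k u => hF.rel_point b k _, fun b k u => hF.ne b k _,
      fun k k' u v huv => ?_⟩, fun k k' u v huv => ?_, fun b k u => ?_⟩
  · rw [hF.lt_iff]
    simp only [(hh _).lt_iff_lt, Fin.castSucc_lt_castSucc_iff]
  · funext i
    exact Fin.castSucc_injective n ((hh i).injective (congrFun (hF.inj _ _ _ _ huv) i))
  · have := hρ (fun i => (min (u i) (v i)).castSucc) (fun i => (max (u i) (v i)).castSucc)
      fun i => Fin.castSucc_lt_castSucc_iff.mpr (min_lt_max.mpr (huv i))
    have := congrFun (congrFun (congrFun (congrArg Prod.fst this)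
      (compareSign u v)) k) k'
    refine Eq.trans ?_ this
    dsimp only
    congr 3 <;> funext i <;> rcases lt_or_gt_of_ne (huv i) with hi | hi <;>
      simp [compareSign, hi, hi.le, hi.not_gt]
  · exact congrFun (congrFun (congrArg Prod.snd (hρ (fun i => (u i).castSucc)
      (fun i => (u i).succ) fun i => Fin.castSucc_lt_succ)) b) k

open Classical in
theorem IsGridEmbedding.rel_eq {e N : ℕ} {x : Bool → P}
    {F : (Bool → Bool) → (Fin e → Fin N) → P} (h : IsGridEmbedding x F) (k k' : Bool → Bool)
    {u v : Fin e → Fin N} (huv : ∀ i, u i ≠ v i) :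
    rel (F k u) (F k' v) = if k ≤ k' ∧ compareSign u v = (fun _ => true) then 1 else
      if k' ≤ k ∧ compareSign u v = (fun _ => false) then -1 else 0 := by
  have h1 : compareSign u v = (fun _ => true) ↔ ∀ i, u i < v i := by
    simp [compareSign, funext_iff]
  have h2 : compareSign u v = (fun _ => false) ↔ ∀ i, v i < u i := by
    simp only [compareSign, funext_iff, decide_eq_false_iff_not, not_lt]
    exact forall_congr' fun i => ⟨fun h => lt_of_le_of_ne h (huv i).symm, le_of_lt⟩
  unfold rel
  simp only [h1, h2, h.lt_iff]

theorem IsCanonicalGrid.isGridPattern {e n : ℕ} (hn : 3 ≤ n) {f : P → P} {x : Bool → P}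
    {F : (Bool → Bool) → (Fin e → Fin n) → P}
    {ρ : (Bool → Bool) → (Bool → Bool) → (Fin e → Bool) → ZMod 3}
    {ν : Bool → (Bool → Bool) → ZMod 3} (h : IsCanonicalGrid f x F ρ ν) : IsGridPattern ρ where
  anti k k' σ := by
    have h1 : ∀ i, ∃ a b : Fin n, a ≠ b ∧ decide (a < b) = σ i ∧ decide (b < a) = !σ i := by
      intro i
      cases σ i
      · exact ⟨⟨1, by omega⟩, ⟨0, by omega⟩, by simp, by simp, by simp⟩
      · exact ⟨⟨0, by omega⟩, ⟨1, by omega⟩, by simp, by simp, by simp⟩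
    choose u v huv h₁ h₂ using h1
    have h₃ := h.rel_grid k k' u v huv
    have h₄ := h.rel_grid k' k v u fun i => (huv i).symm
    rw [rel_swap, h₃] at h₄
    rw [show compareSign u v = σ from funext h₁,
      show compareSign v u = (fun i => !σ i) from funext h₂] at h₄
    exact h₄.symm
  trans k k' k'' σ τ υ hσ hτ hυ := by
    have h1 : ∀ i, ∃ a b c : Fin n, a ≠ b ∧ b ≠ c ∧ a ≠ c ∧ decide (a < b) = σ i ∧
        decide (b < c) = τ i ∧ decide (a < c) = υ i := by
      intro i
      have := hυ i
      generalize σ i = s, τ i = t, υ i = r at this ⊢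
      rcases s <;> rcases t <;> rcases r
      · exact ⟨⟨2, by omega⟩, ⟨1, by omega⟩, ⟨0, by omega⟩, by simp⟩
      · simp at this
      · exact ⟨⟨2, by omega⟩, ⟨0, by omega⟩, ⟨1, by omega⟩, by simp⟩
      · exact ⟨⟨1, by omega⟩, ⟨0, by omega⟩, ⟨2, by omega⟩, by simp⟩
      · exact ⟨⟨1, by omega⟩, ⟨2, by omega⟩, ⟨0, by omega⟩, by simp⟩
      · exact ⟨⟨0, by omega⟩, ⟨2, by omega⟩, ⟨1, by omega⟩, by simp⟩
      · simp at this
      · exact ⟨⟨0, by omega⟩, ⟨1, by omega⟩, ⟨2, by omega⟩, by simp⟩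
    choose u v w huv hvw huw h₁ h₂ h₃ using h1
    have g₁ := h.rel_grid k k' u v huv
    have g₂ := h.rel_grid k' k'' v w hvw
    have g₃ := h.rel_grid k k'' u w huw
    rw [show compareSign u v = σ from funext h₁, hσ, rel_eq_one] at g₁
    rw [show compareSign v w = τ from funext h₂, hτ, rel_eq_one] at g₂
    rw [show compareSign u w = υ from funext h₃, rel_eq_one.mpr (g₁.trans g₂)] at g₃
    exact g₃.symm

theorem IsCanonicalGrid.isPointPattern {e n : ℕ} (hn : 3 ≤ n) {f : P → P} {x : Bool → P}
    {F : (Bool → Bool) → (Fin e → Fin n) → P}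
    {ρ : (Bool → Bool) → (Bool → Bool) → (Fin e → Bool) → ZMod 3}
    {ν : Bool → (Bool → Bool) → ZMod 3} (h : IsCanonicalGrid f x F ρ ν) (b : Bool) :
    IsPointPattern ρ (ν b) := by
  have key : ∀ k k' σ, ∃ y z, rel (f (x b)) y = ν b k ∧ rel (f (x b)) z = ν b k' ∧
      rel y z = ρ k k' σ := by
    intro k k' σ
    have h1 : ∀ i, ∃ a b : Fin n, a ≠ b ∧ decide (a < b) = σ i := by
      intro i
      cases σ i
      · exact ⟨⟨1, by omega⟩, ⟨0, by omega⟩, by simp, by simp⟩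
      · exact ⟨⟨0, by omega⟩, ⟨1, by omega⟩, by simp, by simp⟩
    choose u v huv h₁ using h1
    refine ⟨f (F k u), f (F k' v), h.rel_point_image b k u, h.rel_point_image b k' v, ?_⟩
    rw [h.rel_grid k k' u v huv, show compareSign u v = σ from funext h₁]
  constructor
  · intro k k' σ h₁ h₂
    obtain ⟨y, z, hy, hz, hyz⟩ := key k k' σ
    rw [h₁, rel_eq_one] at hy
    rw [h₂, rel_eq_one] at hyz
    rw [← hz, rel_eq_one]
    exact hy.trans hyz
  · intro k k' σ h₁ h₂
    obtain ⟨z, y, hz, hy, hyz⟩ := key k' k σ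
    rw [h₁, rel_eq_neg_one] at hy
    rw [h₂, rel_eq_one] at hyz
    rw [← hz, rel_eq_neg_one]
    exact hyz.trans hy
  · intro k k' σ h₁ h₂
    obtain ⟨y, z, hy, hz, hyz⟩ := key k k' σ
    rw [h₁, rel_eq_neg_one] at hy
    rw [h₂, rel_eq_one] at hz
    rw [← hyz, rel_eq_one]
    exact hy.trans hz

theorem exists_rank {W : Type} [Fintype W] {a : W → P} (ha : Function.Injective a) :
    ∃ L : W → ℕ, Function.Injective L ∧ (∀ w, L w < Fintype.card W) ∧
      ∀ w w', a w < a w' → L w < L w' := by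
  classical
  let t : W → LinearExtension P := fun w => toLinearExtension (a w)
  have ht : Function.Injective t := fun w w' h => ha h
  have hlt : ∀ w w', t w < t w' → (Finset.univ.filter fun v => t v < t w).card <
      (Finset.univ.filter fun v => t v < t w').card := fun w w' h => by
    refine Finset.card_lt_card ((Finset.ssubset_iff_of_subset fun v hv => ?_).mpr ⟨w, ?_, ?_⟩)
    · simp only [Finset.mem_filter, Finset.mem_univ, true_and] at hv ⊢
      exact hv.trans h
    · simpa using h
    · simp
  refine ⟨fun w => (Finset.univ.filter fun v => t v < t w).card, fun w w' h => ?_, fun w => ?_,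
    fun w w' h => hlt w w' ?_⟩
  · by_contra hw
    rcases lt_or_gt_of_ne fun h' => hw (ht h') with h' | h'
    · exact (hlt _ _ h').ne h
    · exact (hlt _ _ h').ne' h
  · exact Finset.card_lt_univ_of_notMem (x := w) (by simp)
  · exact lt_of_le_of_ne (toLinearExtension.monotone h.le) fun h' => h.ne (congrArg a (ht h'))

/-- Grid coordinates `q` for the tuple `a`, and three further points which compare to `q` in
prescribed ways. -/
structure IsCoordinates {W : Type} {e n : ℕ} (a : W → P) (m : W) (j : Fin e)
    (q : W → Fin e → Fin n) (low iso high : Fin e → Fin n) : Prop where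
  ne : ∀ w w', w ≠ w' → ∀ i, q w i ≠ q w' i
  sign_eq_true : ∀ w w', compareSign (q w) (q w') = (fun _ => true) ↔ a w < a w'
  low_ne : ∀ w i, low i ≠ q w i
  iso_ne : ∀ w i, iso i ≠ q w i
  high_ne : ∀ w i, high i ≠ q w i
  low_of_lt : ∀ w, a m < a w → compareSign low (q w) = fun _ => true
  low_of_not_lt : ∀ w, ¬a m < a w → compareSign low (q w) = flipSign j
  sign_iso : ∀ w, compareSign iso (q w) = flipSign j
  high_of_lt : ∀ w, a m < a w → compareSign high (q w) = fun i => !flipSign j i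
  high_of_not_lt : ∀ w, ¬a m < a w → compareSign high (q w) = fun _ => false

theorem exists_coordinates {W : Type} [Fintype W] {e : ℕ} {g : Fin e → W}
    (hg : ∀ j w, ∃ i, i ≠ j ∧ g i = w) {a : W → P} (ha : Function.Injective a) (m : W)
    (j : Fin e) : ∃ (q : W → Fin e → Fin (2 * Fintype.card W + 3))
      (low iso high : Fin e → Fin (2 * Fintype.card W + 3)),
      IsCoordinates a m j q low iso high := by
  classical
  obtain ⟨L, hL, hLN, hlt⟩ := exists_rank ha
  generalize Fintype.card W = N at hLN
  refine ⟨fun w i => if i = j then (if a m < a w then ⟨N + 2 + L w, by grind⟩ else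
      ⟨L w + 1, by grind⟩) else if a (g i) ≤ a w then ⟨N + L w + 1, by grind⟩ else
      ⟨L w + 1, by grind⟩,
    fun i => if i = j then ⟨N + 1, by omega⟩ else ⟨0, by omega⟩,
    fun i => if i = j then ⟨2 * N + 2, by omega⟩ else ⟨0, by omega⟩,
    fun i => if i = j then ⟨N + 1, by omega⟩ else ⟨2 * N + 2, by omega⟩, ?_⟩
  constructor
  · intro w w' hw i
    have h1 : L w ≠ L w' := fun h => hw (hL h)
    have h2 := hLN w
    have h3 := hLN w'
    split_ifs <;> simp only [ne_eq, Fin.mk.injEq] <;> omega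
  · intro w w'
    simp only [compareSign, funext_iff, decide_eq_true_eq]
    constructor
    · intro h
      obtain ⟨i, hi, rfl⟩ := hg j w
      have h1 := h i
      have := hLN w'
      rw [if_neg hi, if_neg hi, if_pos le_rfl] at h1
      split_ifs at h1 with h2
      · refine lt_of_le_of_ne h2 fun h3 => ?_
        rw [ha h3] at h1
        exact lt_irrefl _ h1
      · rw [Fin.mk_lt_mk] at h1
        omega
    · intro h i
      have := hlt _ _ h
      have := hLN w
      split_ifs with h1 h2 h3 h3 h2 h3 h3
      any_goals rw [Fin.mk_lt_mk]; omega
      · exact absurd (h2.trans h) h3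
      · exact absurd (h2.trans h.le) h3
  · intro w i
    have := hLN w
    split_ifs <;> simp only [ne_eq, Fin.mk.injEq] <;> omega
  · intro w i
    have := hLN w
    split_ifs <;> simp only [ne_eq, Fin.mk.injEq] <;> omega
  · intro w i
    have := hLN w
    split_ifs <;> simp only [ne_eq, Fin.mk.injEq] <;> omega
  · intro w h
    have := hLN w
    funext i
    by_cases hi : i = j <;> simp [compareSign, hi, h] <;> (try split_ifs) <;>
      (try simp [Fin.lt_def]) <;> omega
  · intro w h
    have := hLN w
    funext i
    by_cases hi : i = j <;> simp [compareSign, flipSign, hi, h] <;> (try split_ifs) <;>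
      (try simp [Fin.lt_def]) <;> omega
  · intro w
    have := hLN w
    funext i
    by_cases hi : i = j <;> simp [compareSign, flipSign, hi] <;> (try split_ifs) <;>
      (try simp [Fin.lt_def]) <;> omega
  · intro w h
    have := hLN w
    funext i
    by_cases hi : i = j <;> simp [compareSign, flipSign, hi, h] <;> (try split_ifs) <;>
      (try simp) <;> omega
  · intro w h
    have := hLN w
    funext i
    by_cases hi : i = j <;> simp [compareSign, hi, h] <;> (try split_ifs) <;>
      (try simp) <;> omega

/-- `b` arises from `a` by changing the relations of `m` to the other entries by `φ`. -/
structure IsRetype {W : Type} (φ : ZMod 3 → ZMod 3) (a : W → P) (m : W) (b : W → P) : Prop where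
  body : ∀ w w', w ≠ m → w' ≠ m → rel (b w) (b w') = rel (a w) (a w')
  head : ∀ w, w ≠ m → rel (b m) (b w) = φ (rel (a m) (a w))

/-- Up to `G`, the relations of a minimal entry of a tuple can be changed by `φ`. -/
def Retypes (G : Subgroup (Equiv.Perm P)) (W : Type) (φ : ZMod 3 → ZMod 3) : Prop :=
  ∀ (a : W → P) (m : W), Function.Injective a → (∀ w, ¬a w < a m) →
    ∃ b, Sim G a b ∧ IsRetype φ a m b

/-- The tuple `B` with its entry at `m` replaced by `c` is a retyping of `a`. -/
structure IsConfig {W : Type} (φ : ZMod 3 → ZMod 3) (a : W → P) (m : W) (c : P) (B : W → P) :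
    Prop where
  body : ∀ w w', rel (B w) (B w') = rel (a w) (a w')
  head : ∀ w, w ≠ m → rel c (B w) = φ (rel (a m) (a w))
  inj : Function.Injective B
  ne : ∀ w, c ≠ B w

open Classical in
theorem IsConfig.isRetype {W : Type} {φ : ZMod 3 → ZMod 3} {a : W → P} {m : W} {c : P}
    {B : W → P} (h : IsConfig φ a m c B) : IsRetype φ a m (Function.update B m c) where
  body w w' hw hw' := by
    rw [Function.update_of_ne hw, Function.update_of_ne hw', h.body]
  head w hw := by
    rw [Function.update_of_ne hw, Function.update_self, h.head w hw]

open Classical in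
theorem IsConfig.update_injective {W : Type} {φ : ZMod 3 → ZMod 3} {a : W → P} {m : W} {c : P}
    {B : W → P} (h : IsConfig φ a m c B) : Function.Injective (Function.update B m c) := by
  intro w w' hww
  by_cases hw : w = m <;> by_cases hw' : w' = m
  · rw [hw, hw']
  · subst hw
    rw [Function.update_self, Function.update_of_ne hw'] at hww
    exact absurd hww (h.ne w')
  · subst hw'
    rw [Function.update_self, Function.update_of_ne hw] at hww
    exact absurd hww.symm (h.ne w)
  · rw [Function.update_of_ne hw, Function.update_of_ne hw'] at hww
    exact h.inj hww

theorem rel_eq_of_head {W : Type} {α : Type} [PartialOrder α] {a : W → P} {b : W → α} {m : W}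
    (hbody : ∀ w w', w ≠ m → w' ≠ m → rel (a w) (a w') = rel (b w) (b w'))
    (hhead : ∀ w, w ≠ m → rel (a m) (a w) = rel (b m) (b w)) (w w' : W) :
    rel (a w) (a w') = rel (b w) (b w') := by
  by_cases hw : w = m <;> by_cases hw' : w' = m
  · rw [hw, hw', rel_self, rel_self]
  · rw [hw, hhead w' hw']
  · rw [hw', rel_swap (a m), rel_swap (b m), hhead w hw]
  · exact hbody w w' hw hw'

/-- If the images of two configurations have the same order pattern, then `a` can be retyped. -/
theorem exists_retype (hH : IsHomogeneous P) {G : Subgroup (Equiv.Perm P)}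
    (hR : ∀ f : Equiv.Perm P, (∀ a b : P, Perp a b ↔ Perp (f a) (f b)) → f ∈ G)
    {W : Type} [Finite W] {f : Equiv.Perm P} (hf : f ∈ G) {φ : ZMod 3 → ZMod 3} {a : W → P}
    (ha : Function.Injective a) {m : W} {c c' : P} {B B' : W → P} (h : IsConfig id a m c B)
    (h' : IsConfig φ a m c' B')
    (hB : ∀ w w', rel (f (B w)) (f (B w')) = rel (f (B' w)) (f (B' w')))
    (hc : ∀ w, w ≠ m → rel (f c) (f (B w)) = rel (f c') (f (B' w))) :
    ∃ b, Sim G a b ∧ IsRetype φ a m b := by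
  classical
  refine ⟨Function.update B' m c', ?_, h'.isRetype⟩
  have h1 : Sim G a (Function.update B m c) := by
    refine sim_of_rel_eq hH hR ha h.update_injective (rel_eq_of_head (m := m) ?_ ?_)
    · exact fun w w' hw hw' => (h.isRetype.body w w' hw hw').symm
    · exact fun w hw => (h.isRetype.head w hw).symm
  refine (h1.trans (sim_apply hf _)).trans ((sim_apply hf (Function.update B' m c')).trans ?_).symm
  refine sim_of_rel_eq hH hR (f.injective.comp h'.update_injective)
    (f.injective.comp h.update_injective) (rel_eq_of_head (m := m) ?_ ?_)
  · intro w w' hw hw'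
    simp only [Function.update_of_ne hw, Function.update_of_ne hw']
    exact (hB w w').symm
  · intro w hw
    simp only [Function.update_of_ne hw, Function.update_self]
    exact (hc w hw).symm

theorem rel_of_minimal {W : Type} {a : W → P} {m w : W} [Decidable (a m < a w)]
    (hm : ∀ w, ¬a w < a m) : rel (a m) (a w) = if a m < a w then 1 else 0 := by
  split_ifs with h
  · exact rel_eq_one.mpr h
  · exact rel_eq_zero.mpr ⟨h, hm w⟩

section Configurations

variable {W : Type} {e n : ℕ} {x : Bool → P} {F : (Bool → Bool) → (Fin e → Fin n) → P} {a : W → P}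
  {m : W} {j : Fin e} {q : W → Fin e → Fin n} {low iso high : Fin e → Fin n}

theorem IsGridEmbedding.rel_body (hF : IsGridEmbedding x F)
    (hq : IsCoordinates a m j q low iso high) {κ : W → Bool → Bool}
    (hκ : ∀ w w', a w < a w' → κ w ≤ κ w') (w w' : W) :
    rel (F (κ w) (q w)) (F (κ w') (q w')) = rel (a w) (a w') := by
  have key : ∀ w w', F (κ w) (q w) < F (κ w') (q w') ↔ a w < a w' := fun w w' => by
    rw [hF.lt_iff, ← hq.sign_eq_true w w']
    have h1 : compareSign (q w) (q w') = (fun _ => true) ↔ ∀ i, q w i < q w' i := by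
      simp [compareSign, funext_iff]
    rw [← h1]
    exact ⟨fun h => h.2, fun h => ⟨hκ w w' ((hq.sign_eq_true w w').mp h), h⟩⟩
  unfold rel
  rw [key, key]

theorem IsGridEmbedding.body_injective (hF : IsGridEmbedding x F)
    (hq : IsCoordinates a m j q low iso high) (κ : W → Bool → Bool) :
    Function.Injective fun w => F (κ w) (q w) := by
  intro w w' h
  by_contra hw
  exact hq.ne w w' hw j (congrFun (hF.inj _ _ _ _ h) j)

theorem IsGridEmbedding.isConfig_low (hF : IsGridEmbedding x F)
    (hq : IsCoordinates a m j q low iso high) (hm : ∀ w, ¬a w < a m) {i : Fin e} (hij : i ≠ j)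
    {k k' : Bool → Bool} (hk : k ≤ k') : IsConfig id a m (F k low) fun w => F k' (q w) where
  body := hF.rel_body hq fun _ _ _ => le_rfl
  inj := hF.body_injective hq _
  ne w h := hq.low_ne w j (congrFun (hF.inj _ _ _ _ h) j)
  head w _ := by
    classical
    rw [id, rel_of_minimal hm, hF.rel_eq k k' (hq.low_ne w)]
    split_ifs with h1 h2 h2 h3 h3
    any_goals rfl
    · rw [hq.low_of_not_lt w h2] at h1
      exact absurd h1.2 (flipSign_ne j)
    · rw [hq.low_of_lt w h3] at h2
      exact absurd (congrFun h2.2 i) (by simp)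
    · rw [hq.low_of_not_lt w h3] at h2
      exact absurd h2.2 (flipSign_ne_false hij)
    · exact absurd ⟨hk, hq.low_of_lt w h3⟩ h1

theorem IsGridEmbedding.isConfig_low_of_not_le (hF : IsGridEmbedding x F)
    (hq : IsCoordinates a m j q low iso high) {i : Fin e} (hij : i ≠ j)
    {k k' : Bool → Bool} (hk : ¬k ≤ k') :
    IsConfig (fun _ => 0) a m (F k low) fun w => F k' (q w) where
  body := hF.rel_body hq fun _ _ _ => le_rfl
  inj := hF.body_injective hq _
  ne w h := hq.low_ne w j (congrFun (hF.inj _ _ _ _ h) j)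
  head w _ := by
    rw [hF.rel_eq k k' (hq.low_ne w), if_neg fun h => hk h.1, if_neg]
    rintro ⟨-, h⟩
    by_cases h2 : a m < a w
    · rw [hq.low_of_lt w h2] at h
      exact absurd (congrFun h i) (by simp)
    · rw [hq.low_of_not_lt w h2] at h
      exact flipSign_ne_false hij h

theorem IsGridEmbedding.isConfig_iso (hF : IsGridEmbedding x F)
    (hq : IsCoordinates a m j q low iso high) {i : Fin e} (hij : i ≠ j) (k k' : Bool → Bool) :
    IsConfig (fun _ => 0) a m (F k iso) fun w => F k' (q w) where
  body := hF.rel_body hq fun _ _ _ => le_rfl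
  inj := hF.body_injective hq _
  ne w h := hq.iso_ne w j (congrFun (hF.inj _ _ _ _ h) j)
  head w _ := by
    rw [hF.rel_eq k k' (hq.iso_ne w), hq.sign_iso, if_neg fun h => flipSign_ne j h.2,
      if_neg fun h => flipSign_ne_false hij h.2]

theorem IsGridEmbedding.isConfig_high (hF : IsGridEmbedding x F)
    (hq : IsCoordinates a m j q low iso high) (hm : ∀ w, ¬a w < a m) {i : Fin e} (hij : i ≠ j)
    (k : Bool → Bool) : IsConfig (fun r => r - 1) a m (F k high) fun w => F k (q w) where
  body := hF.rel_body hq fun _ _ _ => le_rfl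
  inj := hF.body_injective hq _
  ne w h := hq.high_ne w j (congrFun (hF.inj _ _ _ _ h) j)
  head w _ := by
    classical
    rw [rel_of_minimal hm, hF.rel_eq k k (hq.high_ne w)]
    by_cases h : a m < a w
    · rw [hq.high_of_lt w h, if_neg, if_neg, if_pos h]
      · rfl
      · exact fun h2 => absurd (congrFun h2.2 j) (by simp [flipSign])
      · exact fun h2 => absurd (congrFun h2.2 i) (by simp [flipSign, hij])
    · rw [hq.high_of_not_lt w h, if_neg, if_pos ⟨le_rfl, rfl⟩, if_neg h]
      · rfl
      · exact fun h2 => absurd (congrFun h2.2 j) (by simp)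

open Classical in
theorem IsGridEmbedding.isConfig_point (hF : IsGridEmbedding x F)
    (hq : IsCoordinates a m j q low iso high) (hm : ∀ w, ¬a w < a m) {b : Bool}
    {k k' : Bool → Bool} (hk : k ≤ k') (hb : k b = false) (hb' : k' b = true) :
    IsConfig id a m (x b) fun w => F (if a m < a w then k' else k) (q w) where
  body := hF.rel_body hq fun w w' h => by
    split_ifs with h1 h2
    exacts [le_rfl, absurd (h1.trans h) h2, hk, le_rfl]
  inj := hF.body_injective hq fun w => if a m < a w then k' else k
  ne w := hF.ne b _ _
  head w _ := by
    rw [hF.rel_point, id, rel_of_minimal hm]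
    split_ifs <;> simp_all

theorem IsGridEmbedding.isConfig_point_iso (hF : IsGridEmbedding x F)
    (hq : IsCoordinates a m j q low iso high) {b : Bool} {k : Bool → Bool} (hb : k b = false) :
    IsConfig (fun _ => 0) a m (x b) fun w => F k (q w) where
  body := hF.rel_body hq fun _ _ _ => le_rfl
  inj := hF.body_injective hq _
  ne w := hF.ne b _ _
  head w _ := by rw [hF.rel_point, hb]; rfl

end Configurations

theorem IsCanonicalGrid.rel_image_eq {e n : ℕ} {f : P → P} {x : Bool → P}
    {F : (Bool → Bool) → (Fin e → Fin n) → P}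
    {ρ : (Bool → Bool) → (Bool → Bool) → (Fin e → Bool) → ZMod 3}
    {ν : Bool → (Bool → Bool) → ZMod 3} (h : IsCanonicalGrid f x F ρ ν) (hρ : IsGridPattern ρ)
    {s : ZMod 3} (he : 0 < e)
    (hcell : ∀ k, ρ k k (fun _ => true) = s ∧
      ∀ σ, σ ≠ (fun _ => true) → σ ≠ (fun _ => false) → ρ k k σ = 0)
    (hpair : ∀ k k', k < k' → ρ k k' (fun _ => true) = s ∧
      ∀ σ, σ ≠ (fun _ => true) → ρ k k' σ = 0)
    {k k' : Bool → Bool} (hk : k ≤ k') {u v : Fin e → Fin n} (huv : ∀ i, u i ≠ v i) :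
    rel (f (F k u)) (f (F k' v)) = s * rel (F k u) (F k' v) := by
  have htf : (fun _ : Fin e => false) ≠ fun _ => true := fun h => by
    simpa using congrFun h ⟨0, he⟩
  rw [h.rel_grid k k' u v huv, h.rel_eq k k' huv]
  by_cases h1 : compareSign u v = fun _ => true
  · rw [if_pos ⟨hk, h1⟩, h1, mul_one]
    rcases hk.eq_or_lt with rfl | hk
    exacts [(hcell k).1, (hpair k k' hk).1]
  rw [if_neg fun h => h1 h.2]
  rcases hk.eq_or_lt with rfl | hk
  · split_ifs with h2
    · rw [h2.2, mul_neg, mul_one, ← (hcell k).1]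
      exact hρ.anti k k fun _ => true
    · rw [mul_zero]
      exact (hcell k).2 _ h1 fun h => h2 ⟨le_rfl, h⟩
  · rw [if_neg fun h => hk.not_ge h.1, mul_zero]
    exact (hpair k k' hk).2 _ h1

/-- If neither isolation nor rotation of minimal entries is possible in all tuples, then `f` keeps
or reverses all relations in a canonical grid. -/
theorem IsCanonicalGrid.eq_of_not_retypes (hH : IsHomogeneous P) {G : Subgroup (Equiv.Perm P)}
    (hR : ∀ f : Equiv.Perm P, (∀ a b : P, Perp a b ↔ Perp (f a) (f b)) → f ∈ G)
    {W : Type} [Fintype W] {e : ℕ} (he : 3 ≤ e) {g : Fin e → W}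
    (hg : ∀ j w, ∃ i, i ≠ j ∧ g i = w)
    (hiso : ¬Retypes G W fun _ => 0) (hrot : ¬Retypes G W fun r => r - 1)
    {f : Equiv.Perm P} (hf : f ∈ G) {x : Bool → P}
    {F : (Bool → Bool) → (Fin e → Fin (2 * Fintype.card W + 3)) → P}
    {ρ : (Bool → Bool) → (Bool → Bool) → (Fin e → Bool) → ZMod 3}
    {ν : Bool → (Bool → Bool) → ZMod 3} (hF : IsCanonicalGrid f x F ρ ν) :
    ∃ s : ZMod 3, (s = 1 ∨ s = -1) ∧ ∀ b k k', k < k' → k b = false → k' b = true →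
      ν b k = 0 ∧ ν b k' = s := by
  classical
  have hρ := hF.isGridPattern (by omega)
  unfold Retypes at hiso hrot
  push Not at hiso hrot
  obtain ⟨a₁, m₁, ha₁, hm₁, hiso⟩ := hiso
  obtain ⟨a₂, m₂, ha₂, hm₂, hrot⟩ := hrot
  have hij : ∀ j : Fin e, ∃ i, i ≠ j := fun j => (hg j m₁).imp fun _ h => h.1
  choose o ho using hij
  choose q₁ low₁ iso₁ high₁ hq₁ using exists_coordinates hg ha₁ m₁
  choose q₂ low₂ iso₂ high₂ hq₂ using exists_coordinates hg ha₂ m₂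
  have ne : ∀ k k', k ≤ k' → ∀ j, ρ k k' (fun _ => true) ≠ ρ k k' (flipSign j) := by
    intro k k' hk j heq
    obtain ⟨b, hb, hb'⟩ := exists_retype hH hR hf ha₁ (hF.isConfig_low (hq₁ j) hm₁ (ho j) hk)
      (hF.isConfig_iso (hq₁ j) (ho j) k k') (fun _ _ => rfl) fun w _ => by
        rw [hF.rel_grid _ _ _ _ ((hq₁ j).low_ne w), hF.rel_grid _ _ _ _ ((hq₁ j).iso_ne w),
          (hq₁ j).sign_iso]
        by_cases h : a₁ m₁ < a₁ w
        · rw [(hq₁ j).low_of_lt w h, heq]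
        · rw [(hq₁ j).low_of_not_lt w h]
    exact hiso b hb hb'
  have drop : ∀ k k', k < k' → ∀ j, ¬(ρ k' k (fun _ => true) = ρ k k (fun _ => true) ∧
      ρ k' k (flipSign j) = ρ k k (flipSign j)) := by
    rintro k k' hk j ⟨h₁, h₂⟩
    obtain ⟨b, hb, hb'⟩ := exists_retype hH hR hf ha₁
      (hF.isConfig_low (hq₁ j) hm₁ (ho j) (le_refl k))
      (hF.isConfig_low_of_not_le (hq₁ j) (ho j) hk.not_ge) (fun _ _ => rfl) fun w _ => by
        rw [hF.rel_grid _ _ _ _ ((hq₁ j).low_ne w), hF.rel_grid _ _ _ _ ((hq₁ j).low_ne w)]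
        by_cases h : a₁ m₁ < a₁ w
        · rw [(hq₁ j).low_of_lt w h, h₁]
        · rw [(hq₁ j).low_of_not_lt w h, h₂]
    exact hiso b hb hb'
  have hcell : ∀ k, ∃ s : ZMod 3, (s = 1 ∨ s = -1) ∧ ρ k k (fun _ => true) = s ∧
      ∀ σ, σ ≠ (fun _ => true) → σ ≠ (fun _ => false) → ρ k k σ = 0 := fun k =>
    grid_pattern_eq (ρ k k) (hρ.anti k k) (hρ.trans k k k) (ne k k le_rfl)
      ⟨⟨0, by omega⟩, ⟨1, by omega⟩, ⟨2, by omega⟩, by simp, by simp, by simp⟩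
  choose s hs hs₁ hs₀ using hcell
  have high_image : ∀ k j w, rel (f (F k (high₂ j))) (f (F k (q₂ j w))) =
      if a₂ m₂ < a₂ w then 0 else -s k := by
    intro k j w
    rw [hF.rel_grid _ _ _ _ ((hq₂ j).high_ne w)]
    split_ifs with h
    · rw [(hq₂ j).high_of_lt w h, hρ.anti k k, hs₀ k _ (flipSign_ne j)
        (flipSign_ne_false (ho j)), neg_zero]
    · rw [(hq₂ j).high_of_not_lt w h, ← hs₁ k]
      exact hρ.anti k k fun _ => true
  have rot : ∀ k k', k < k' → ∀ j, ¬(ρ k k' (fun _ => true) = 0 ∧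
      ρ k k' (flipSign j) = -s k') := by
    rintro k k' hk j ⟨h₁, h₂⟩
    obtain ⟨b, hb, hb'⟩ := exists_retype hH hR hf ha₂
      (hF.isConfig_low (hq₂ j) hm₂ (ho j) hk.le)
      (hF.isConfig_high (hq₂ j) hm₂ (ho j) k') (fun _ _ => rfl) fun w _ => by
        rw [hF.rel_grid _ _ _ _ ((hq₂ j).low_ne w), high_image]
        split_ifs with h
        · rw [(hq₂ j).low_of_lt w h, h₁]
        · rw [(hq₂ j).low_of_not_lt w h, h₂]
    exact hrot b hb hb'
  have hpair : ∀ k k', k < k' → s k = s k' ∧ ρ k k' (fun _ => true) = s k' ∧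
      ∀ σ, σ ≠ (fun _ => true) → ρ k k' σ = 0 := fun k k' hk =>
    hρ.eq_between (hs k) (hs k') (hs₁ k) (hs₀ k) (hs₁ k') (ne k k' hk.le) (drop k k' hk)
      (rot k k' hk) ⟨⟨0, by omega⟩, ⟨1, by omega⟩, by simp⟩
  have hconst : ∀ k, s k = s ⊤ := fun k => by
    rcases (le_top : k ≤ ⊤).eq_or_lt with hk | hk
    · rw [hk]
    · exact (hpair k ⊤ hk).1
  have image : ∀ {a : W → P} {m j} {q : W → Fin e → Fin (2 * Fintype.card W + 3)} {low iso high}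
      (_ : IsCoordinates a m j q low iso high) (κ : W → Bool → Bool)
      (_ : ∀ w w', a w < a w' → κ w ≤ κ w') (_ : ∀ w w', κ w ≤ κ w' ∨ κ w' ≤ κ w) (w w'),
      rel (f (F (κ w) (q w))) (f (F (κ w') (q w'))) = s ⊤ * rel (a w) (a w') := by
    intro a m j q low iso high hq κ hκ hκ' w w'
    have key : ∀ w w', w ≠ w' → κ w ≤ κ w' →
        rel (f (F (κ w) (q w))) (f (F (κ w') (q w'))) = s ⊤ * rel (a w) (a w') := by
      intro w w' hw h
      rw [← hF.rel_body hq hκ]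
      refine hF.rel_image_eq hρ (by omega) (fun k => ⟨(hs₁ k).trans (hconst k), hs₀ k⟩)
        (fun k k' hk => ?_) h (hq.ne w w' hw)
      rw [← hconst k']
      exact (hpair k k' hk).2
    by_cases hw : w = w'
    · rw [hw, rel_self, rel_self, mul_zero]
    rcases hκ' w w' with h | h
    · exact key w w' hw h
    · rw [rel_swap (f (F (κ w') (q w'))), key w' w (Ne.symm hw) h, rel_swap (a w), mul_neg,
        neg_neg]
  have mixed_le : ∀ {k k' : Bool → Bool} (_ : k ≤ k') (a : W → P) (m w w'), a w < a w' →
      (if a m < a w then k' else k) ≤ if a m < a w' then k' else k := by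
    intro k k' hk a m w w' h
    split_ifs with h1 h2
    exacts [le_rfl, absurd (h1.trans h) h2, hk, le_rfl]
  have mixed_total : ∀ {k k' : Bool → Bool} (_ : k ≤ k') (a : W → P) (m w w'),
      (if a m < a w then k' else k) ≤ (if a m < a w' then k' else k) ∨
      (if a m < a w' then k' else k) ≤ if a m < a w then k' else k := by
    intro k k' hk a m w w'
    split_ifs
    exacts [Or.inl le_rfl, Or.inr hk, Or.inl hk, Or.inl le_rfl]
  let j : Fin e := ⟨0, by omega⟩
  refine ⟨s ⊤, hs ⊤, fun b k k' hk hb hb' => ?_⟩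
  refine (hF.isPointPattern (by omega) b).eq_of_ne hρ (hs ⊤) (σ := fun _ => true)
    (τ := fun _ => false) (by rw [← hconst k']; exact (hpair k k' hk).2.1)
    ((hpair k k' hk).2.2 _ fun h => by simpa using congrFun h j) (fun heq => ?_) ?_
  · obtain ⟨c, hc, hc'⟩ := exists_retype hH hR hf ha₁
      (hF.isConfig_point (hq₁ j) hm₁ hk.le hb hb') (hF.isConfig_point_iso (hq₁ j) hb)
      (fun w w' => by
        rw [image (hq₁ j) (fun w => if a₁ m₁ < a₁ w then k' else k) (mixed_le hk.le a₁ m₁)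
          (mixed_total hk.le a₁ m₁), image (hq₁ j) (fun _ => k) (fun _ _ _ => le_rfl)
          (fun _ _ => Or.inl le_rfl)])
      fun w _ => by
        rw [hF.rel_point_image, hF.rel_point_image]
        split_ifs
        exacts [heq.symm, rfl]
    exact hiso c hc hc'
  · rintro ⟨h₁, h₂⟩
    obtain ⟨c, hc, hc'⟩ := exists_retype hH hR hf ha₂
      (hF.isConfig_point (hq₂ j) hm₂ hk.le hb hb') (hF.isConfig_high (hq₂ j) hm₂ (ho j) k')
      (fun w w' => by
        rw [image (hq₂ j) (fun w => if a₂ m₂ < a₂ w then k' else k) (mixed_le hk.le a₂ m₂)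
          (mixed_total hk.le a₂ m₂), image (hq₂ j) (fun _ => k') (fun _ _ _ => le_rfl)
          (fun _ _ => Or.inl le_rfl)])
      fun w _ => by
        rw [hF.rel_point_image, high_image, hconst k']
        split_ifs
        exacts [h₁, h₂]
    exact hrot c hc hc'

theorem retypes_or (hU : IsUniversal P) (hH : IsHomogeneous P) {G : Subgroup (Equiv.Perm P)}
    (hR : ∀ f : Equiv.Perm P, (∀ a b : P, Perp a b ↔ Perp (f a) (f b)) → f ∈ G)
    (hne : ∃ f ∈ G, ¬∀ a b : P, Perp a b ↔ Perp ((f : Equiv.Perm P) a) (f b))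
    (W : Type) [Fintype W] : Retypes G W (fun _ => 0) ∨ Retypes G W fun r => r - 1 := by
  by_contra! ⟨hiso, hrot⟩
  have hW : 0 < Fintype.card W := by
    unfold Retypes at hiso
    push Not at hiso
    obtain ⟨-, m, -⟩ := hiso
    exact Fintype.card_pos_iff.mpr ⟨m⟩
  obtain ⟨f, hf, x, hx, hxf⟩ : ∃ f ∈ G, ∃ x : Bool → P, Perp (x false) (x true) ∧
      rel ((f : Equiv.Perm P) (x false)) (f (x true)) ≠ 0 := by
    obtain ⟨f, hf, h⟩ := hne
    push Not at h
    obtain ⟨a, b, h⟩ := h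
    have key : ∀ (f : Equiv.Perm P) (a b : P), Perp a b → ¬Perp (f a) (f b) →
        rel (f a) (f b) ≠ 0 := fun f a b h h' h0 =>
      h' (perp_iff_rel.mpr ⟨fun h1 => (perp_iff_rel.mp h).1 (f.injective h1), h0⟩)
    rcases h with h | h
    · exact ⟨f, hf, fun c => if c then b else a, h.1, key f a b h.1 h.2⟩
    · refine ⟨f⁻¹, G.inv_mem hf, fun c => if c then f b else f a, h.2, ?_⟩
      exact key f⁻¹ (f a) (f b) h.2 (by simpa using h.1)
  let E := Fintype.equivFin (W × Fin 3)
  have hcard : Fintype.card (W × Fin 3) = Fintype.card W * 3 := by simp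
  have hg : ∀ j w, ∃ i, i ≠ j ∧ (E.symm i).1 = w := by
    intro j w
    by_cases h : E (w, 0) = j
    · exact ⟨E (w, 1), fun h' => by simpa using E.injective (h'.trans h.symm), by simp⟩
    · exact ⟨E (w, 0), h, by simp⟩
  obtain ⟨F, ρ, ν, hF⟩ := exists_canonicalGrid hU hH (e := Fintype.card (W × Fin 3)) (by omega)
    (2 * Fintype.card W + 3) hx f
  obtain ⟨s, hs, hν⟩ := hF.eq_of_not_retypes hH hR (by omega) hg hiso hrot hf
  obtain ⟨b, hb⟩ : ∃ b, rel (f (x b)) (f (x !b)) = s := by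
    have h := rel_swap (f (x false)) (f (x true))
    rcases hs with rfl | rfl <;> rcases zmod_three_cases (rel (f (x false)) (f (x true)))
      with h' | h' | h'
    · exact absurd h' hxf
    · exact ⟨false, h'⟩
    · exact ⟨true, h.trans (by rw [h', neg_neg])⟩
    · exact absurd h' hxf
    · exact ⟨true, h.trans (by rw [h'])⟩
    · exact ⟨false, h'⟩
  let r : Bool → Bool := fun b' => decide (b' ≠ b)
  have hbot : ⊥ < r := by
    refine lt_of_le_of_ne bot_le fun h => ?_
    simpa [r] using congrFun h !b
  have htop : r < ⊤ := by
    refine lt_of_le_of_ne le_top fun h => ?_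
    simpa [r] using congrFun h b
  have h₁ : ν b r = 0 := (hν b r ⊤ htop (by simp [r]) rfl).1
  have h₂ : ν (!b) r = s := (hν (!b) ⊥ r hbot rfl (by simp [r])).2
  let u : Fin (Fintype.card (W × Fin 3)) → Fin (2 * Fintype.card W + 3) := fun _ => 0
  rw [← hF.rel_point_image b r u] at h₁
  rw [← hF.rel_point_image (!b) r u] at h₂
  rcases hs with rfl | rfl
  · rw [rel_eq_one] at hb h₂
    exact (rel_eq_zero.mp h₁).1 (hb.trans h₂)
  · rw [rel_eq_neg_one] at hb h₂
    exact (rel_eq_zero.mp h₁).2 (h₂.trans hb)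

/-- Retyping the elements of a lower set of a tuple, one minimal element after the other. -/
theorem Retypes.lowerSet {G : Subgroup (Equiv.Perm P)} {W : Type} {φ : ZMod 3 → ZMod 3}
    (h : Retypes G W φ) (h₀ : φ 0 ≠ 1) (h₁ : φ 1 ≠ 1) (hφ : ∀ r, φ (-φ (-r)) = -φ (-φ r))
    [DecidableEq W] (X : Finset W) (a : W → P) (ha : Function.Injective a)
    (hX : ∀ w, ∀ x ∈ X, a w < a x → w ∈ X) :
    ∃ b, Sim G a b ∧ ∀ i j, i ≠ j → rel (b i) (b j) =
      -(if j ∈ X then φ else id) (-(if i ∈ X then φ else id) (rel (a i) (a j))) := by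
  induction hn : X.card generalizing X a with
  | zero =>
    rw [Finset.card_eq_zero] at hn
    subst hn
    exact ⟨a, ⟨1, G.one_mem, fun _ => rfl⟩, fun i j _ => by simp⟩
  | succ n ih =>
    obtain ⟨m, hmX, hmin⟩ := X.exists_minimalFor a (Finset.card_pos.mp (by omega))
    have hm : ∀ w, ¬a w < a m := fun w hw => hw.not_ge (hmin (hX w m hmX hw) hw.le)
    obtain ⟨b, hab, hb⟩ := h a m ha hm
    obtain ⟨c, hbc, hc⟩ := ih (X.erase m) b (hab.injective ha) (fun w x hx hwx => by
      obtain ⟨hxm, hx⟩ := Finset.mem_erase.mp hx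
      by_cases hw : w = m
      · exfalso
        subst hw
        rw [← rel_eq_one, hb.head x hxm] at hwx
        rcases zmod_three_cases (rel (a w) (a x)) with h2 | h2 | h2
        · exact h₀ (h2 ▸ hwx)
        · exact h₁ (h2 ▸ hwx)
        · exact hm x (rel_eq_neg_one.mp h2)
      · rw [← rel_eq_one, hb.body w x hw hxm, rel_eq_one] at hwx
        exact Finset.mem_erase.mpr ⟨hw, hX w x hx hwx⟩)
      (by rw [Finset.card_erase_of_mem hmX, hn]; rfl)
    refine ⟨c, hab.trans hbc, fun i j hij => ?_⟩
    rw [hc i j hij]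
    simp only [Finset.mem_erase]
    by_cases hi : i = m
    · subst hi
      simp [hb.head j hij.symm, hij.symm, hmX]
    by_cases hj : j = m
    · subst hj
      rw [rel_swap (b j) (b i), hb.head i hij, rel_swap (a i)]
      by_cases hiX : i ∈ X
      · simp [hi, hmX, hiX, hφ]
      · simp [hmX, hiX]
    · rw [hb.body i j hi hj]
      simp only [ne_eq, hi, hj, not_false_eq_true, true_and]

theorem sim_of_retypes_zero (hH : IsHomogeneous P) {G : Subgroup (Equiv.Perm P)}
    (hR : ∀ f : Equiv.Perm P, (∀ a b : P, Perp a b ↔ Perp (f a) (f b)) → f ∈ G)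
    {W : Type} [Fintype W] (h : Retypes G W fun _ => 0) {a b : W → P}
    (ha : Function.Injective a) (hb : Function.Injective b) : Sim G a b := by
  classical
  have key : ∀ a : W → P, Function.Injective a →
      ∃ c, Sim G a c ∧ ∀ i j, rel (c i) (c j) = 0 := fun a ha => by
    obtain ⟨c, hac, hc⟩ := h.lowerSet (by decide) (by decide) (by decide) Finset.univ a ha
      (by simp)
    refine ⟨c, hac, fun i j => ?_⟩
    by_cases hij : i = j
    · rw [hij, rel_self]
    · simpa using hc i j hij
  obtain ⟨c, hac, hc⟩ := key a ha
  obtain ⟨d, hbd, hd⟩ := key b hb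
  exact (hac.trans (sim_of_rel_eq hH hR (hac.injective ha) (hbd.injective hb)
    fun i j => by rw [hc, hd])).trans hbd.symm

theorem BehavesLikeId.rel_eq {f : P → P} {X : Set P} (h : BehavesLikeId f X) {x y : P}
    (hx : x ∈ X) (hy : y ∈ X) : rel (f x) (f y) = rel x y := by
  rcases eq_or_ne x y with rfl | hxy
  · rw [rel_self, rel_self]
  rcases zmod_three_cases (rel x y) with h0 | h0 | h0 <;> rw [h0]
  · exact (perp_iff_rel.mp ((h x hx y hy).2 (perp_iff_rel.mpr ⟨hxy, h0⟩))).2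
  · exact rel_eq_one.mpr ((h x hx y hy).1 (rel_eq_one.mp h0))
  · exact rel_eq_neg_one.mpr ((h y hy x hx).1 (rel_eq_neg_one.mp h0))

theorem rel_eq_sub_one {f : P → P} {x y : P} (hxy : x ≠ y) (hyx : ¬y < x)
    (h : (f y < f x ↔ Perp x y) ∧ (Perp (f x) (f y) ↔ x < y)) :
    rel (f x) (f y) = rel x y - 1 := by
  rcases zmod_three_cases (rel x y) with h0 | h0 | h0
  · rw [h0, zero_sub, rel_eq_neg_one]
    exact h.1.mpr (perp_iff_rel.mpr ⟨hxy, h0⟩)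
  · rw [h0, sub_self]
    exact (perp_iff_rel.mp (h.2.mpr (rel_eq_one.mp h0))).2
  · exact absurd (rel_eq_neg_one.mp h0) hyx

/-- A rotation changes the relations in the same way as first rotating `X ∪ Y` and then `X`. -/
theorem IsRotation.exists_rel_eq {f : Equiv.Perm P} (hf : IsRotation f) :
    ∃ A B : Set P, B ⊆ A ∧ IsLowerSet A ∧ IsLowerSet B ∧ (∀ x ∈ B, ∀ z ∉ A, x < z) ∧
      ∀ [DecidablePred (· ∈ A)] [DecidablePred (· ∈ B)] (x y : P), rel (f x) (f y) = rel x y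
        - (if x ∈ A then 1 else 0) + (if y ∈ A then 1 else 0)
        - (if x ∈ B then 1 else 0) + (if y ∈ B then 1 else 0) := by
  obtain ⟨X, Y, Z, hc, hXY, hXZ, hYZ, hX, hZ, hlt, fX, fY, fZ, fXZ, fXY, fYZ⟩ := hf
  rw [Set.disjoint_left] at hXY hXZ hYZ
  refine ⟨Zᶜ, X, fun x hx => hXZ hx, hZ.compl, hX, fun x hx z hz => hlt x hx z (not_not.mp hz),
    ?_⟩
  intro _ _ x y
  have key : ∀ x y, rel (f x) (f y) = rel x y
        - (if x ∈ Zᶜ then 1 else 0) + (if y ∈ Zᶜ then 1 else 0)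
        - (if x ∈ X then 1 else 0) + (if y ∈ X then 1 else 0) →
      rel (f y) (f x) = rel y x
        - (if y ∈ Zᶜ then 1 else 0) + (if x ∈ Zᶜ then 1 else 0)
        - (if y ∈ X then 1 else 0) + (if x ∈ X then 1 else 0) := fun x y h => by
    rw [rel_swap (f x), h, rel_swap x]
    ring
  have hxy : ∀ x ∈ X, ∀ y ∈ Y, rel (f x) (f y) = rel x y - 1 := fun x hx y hy =>
    rel_eq_sub_one (fun h => hXY hx (h ▸ hy)) (fun h => hXY (hX h.le hx) hy) (fXY x hx y hy)
  have hyz : ∀ y ∈ Y, ∀ z ∈ Z, rel (f y) (f z) = rel y z - 1 := fun y hy z hz =>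
    rel_eq_sub_one (fun h => hYZ hy (h ▸ hz)) (fun h => hYZ hy (hZ h.le hz)) (fYZ y hy z hz)
  have hxz : ∀ x ∈ X, ∀ z ∈ Z, rel (f x) (f z) = rel x z - 1 - 1 := fun x hx z hz => by
    rw [rel_eq_one.mpr (hlt x hx z hz), rel_eq_neg_one.mpr (fXZ x hx z hz)]
    decide
  have mem : ∀ x, (x ∈ X ∧ x ∉ Z) ∨ (x ∈ Y ∧ x ∉ X ∧ x ∉ Z) ∨ (x ∈ Z ∧ x ∉ X) := fun x => by
    rcases hc x with h | h | h
    · exact Or.inl ⟨h, hXZ h⟩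
    · exact Or.inr (Or.inl ⟨h, fun h' => hXY h' h, hYZ h⟩)
    · exact Or.inr (Or.inr ⟨h, fun h' => hXZ h' h⟩)
  rcases mem x with ⟨h₁, h₂⟩ | ⟨h₁, h₂, h₃⟩ | ⟨h₁, h₂⟩ <;>
    rcases mem y with ⟨g₁, g₂⟩ | ⟨g₁, g₂, g₃⟩ | ⟨g₁, g₂⟩
  · simp [fX.rel_eq h₁ g₁, *]
  · simp [hxy x h₁ y g₁, *]
  · simp [hxz x h₁ y g₁, *]
  · refine key y x ?_
    simp [hxy y g₁ x h₁, *]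
  · simp [fY.rel_eq h₁ g₁, *]
  · simp [hyz x h₁ y g₁, *]
  · refine key y x ?_
    simp [hxz y g₁ x h₁, *]
  · refine key y x ?_
    simp [hyz y g₁ x h₁, *]
  · simp [fZ.rel_eq h₁ g₁, *]

theorem sim_of_retypes_sub_one (hH : IsHomogeneous P) {G : Subgroup (Equiv.Perm P)}
    (hR : ∀ f : Equiv.Perm P, (∀ a b : P, Perp a b ↔ Perp (f a) (f b)) → f ∈ G)
    {W : Type} [Fintype W] (h : Retypes G W fun r => r - 1) {a : W → P}
    (ha : Function.Injective a) {f : Equiv.Perm P} (hf : IsRotation f) :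
    Sim G a fun w => f (a w) := by
  classical
  obtain ⟨A, B, hBA, hA, hB, hlt, hrel⟩ := hf.exists_rel_eq
  obtain ⟨b, hab, hb⟩ := h.lowerSet (by decide) (by decide) (by decide)
    (Finset.univ.filter fun w => a w ∈ A) a ha fun w x hx hwx => by
      simp only [Finset.mem_filter, Finset.mem_univ, true_and] at hx ⊢
      exact hA hwx.le hx
  have hb' : ∀ i j, i ≠ j → rel (b i) (b j) = rel (a i) (a j) -
      (if a i ∈ A then 1 else 0) + (if a j ∈ A then 1 else 0) := fun i j hij => by
    rw [hb i j hij]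
    by_cases hi : a i ∈ A <;> by_cases hj : a j ∈ A <;> simp [hi, hj] <;> ring
  obtain ⟨c, hbc, hc⟩ := h.lowerSet (by decide) (by decide) (by decide)
    (Finset.univ.filter fun w => a w ∈ B) b (hab.injective ha) fun w x hx hwx => by
      simp only [Finset.mem_filter, Finset.mem_univ, true_and] at hx ⊢
      have hwx' : w ≠ x := fun h => hwx.ne (congrArg b h)
      rw [← rel_eq_one, hb' w x hwx', if_pos (hBA hx)] at hwx
      by_cases hw : a w ∈ A
      · rw [if_pos hw, sub_add_cancel, rel_eq_one] at hwx
        exact hB hwx.le hx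
      · rw [if_neg hw, rel_eq_neg_one.mpr (hlt _ hx _ hw)] at hwx
        exact absurd hwx (by decide)
  refine (hab.trans hbc).trans (sim_of_rel_eq hH hR ((hab.trans hbc).injective ha)
    (f.injective.comp ha) fun i j => ?_)
  by_cases hij : i = j
  · rw [hij, rel_self, rel_self]
  rw [hc i j hij, hb' i j hij, hrel]
  by_cases hi : a i ∈ B <;> by_cases hj : a j ∈ B <;> simp [hi, hj] <;> ring

/-- A closed group strictly above the group of incomparability-preserving
permutations contains all rotations. -/
theorem closed_group_above_rev [Countable P] [Infinite P]
    (hU : IsUniversal P) (hH : IsHomogeneous P)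
    (G : Subgroup (Equiv.Perm P)) (hG : IsClosedSubgroup G)
    (hR : ∀ f : Equiv.Perm P, (∀ a b : P, Perp a b ↔ Perp (f a) (f b)) → f ∈ G)
    (hne : ∃ f ∈ G, ¬ (∀ a b : P, Perp a b ↔ Perp ((f : Equiv.Perm P) a) (f b))) :
    ∀ f : Equiv.Perm P, IsRotation f → f ∈ G := by
  refine fun f hf => hG f fun S => ?_
  have ha : Function.Injective (Subtype.val : S → P) := Subtype.val_injective
  have h : Sim G (Subtype.val : S → P) fun w => f w := by
    rcases retypes_or hU hH hR hne S with h | h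
    · exact sim_of_retypes_zero hH hR h ha (f.injective.comp ha)
    · exact sim_of_retypes_sub_one hH hR h ha hf
  obtain ⟨g, hg, h⟩ := h
  exact ⟨g, hg, fun x hx => h ⟨x, hx⟩⟩
end

section
/- The composition of two rotations of P is again a rotation of P. -/
variable {P : Type} [PartialOrder P]

open Classical in
/-- The comparison of `a` and `b` as an integer: `1` if `a < b`, `-1` if `b < a`, else `0`. -/
noncomputable def compSign (a b : P) : ℤ := if a < b then 1 else if b < a then -1 else 0

theorem compSign_eq_one_iff {a b : P} : compSign a b = 1 ↔ a < b := by
  unfold compSign; split_ifs <;> simp_all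

theorem compSign_eq_neg_one_iff {a b : P} : compSign a b = -1 ↔ b < a := by
  unfold compSign
  split_ifs with h₁ h₂
  · simpa using h₁.le.not_gt
  · simpa using h₂
  · simpa using h₂

theorem perp_iff_not_lt {a b : P} (h : a ≠ b) : Perp a b ↔ ¬ a < b ∧ ¬ b < a := by
  simp only [Perp, lt_iff_le_and_ne, h, h.symm, ne_eq, not_false_eq_true, and_true]

theorem compSign_mem (a b : P) : compSign a b = 1 ∨ compSign a b = -1 ∨ compSign a b = 0 := by
  unfold compSign; split_ifs <;> simp

theorem compSign_eq_zero_iff {a b : P} (h : a ≠ b) : compSign a b = 0 ↔ Perp a b := by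
  rw [perp_iff_not_lt h, ← compSign_eq_one_iff, ← compSign_eq_neg_one_iff]
  have := compSign_mem a b
  omega

theorem compSign_self (a : P) : compSign a a = 0 := by simp [compSign]

theorem compSign_swap (a b : P) : compSign b a = -compSign a b := by
  have h₁ := compSign_mem a b
  have h₂ := compSign_mem b a
  have h₃ := (compSign_eq_one_iff (a := a) (b := b)).trans compSign_eq_neg_one_iff.symm
  have h₄ := (compSign_eq_one_iff (a := b) (b := a)).trans compSign_eq_neg_one_iff.symm
  omega

/-- `f` changes comparison signs by the coboundary of the integer-valued level function `l`. -/
def ShiftsBy (f : Equiv.Perm P) (l : P → ℤ) : Prop :=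
  ∀ a b : P, compSign (f a) (f b) = compSign a b + l a - l b

theorem ShiftsBy.mul {f g : Equiv.Perm P} {l m : P → ℤ} (hf : ShiftsBy f l)
    (hg : ShiftsBy g m) : ShiftsBy (f * g) (fun p => m p + l (g p)) := by
  intro a b
  have h₁ := hf (g a) (g b)
  have h₂ := hg a b
  simp only [Equiv.Perm.mul_apply]
  omega

theorem ShiftsBy.sub_le_two {f : Equiv.Perm P} {l : P → ℤ} (h : ShiftsBy f l) (a b : P) :
    l a - l b ≤ 2 := by
  have h₁ := h a b
  have h₂ := compSign_mem a b
  have h₃ := compSign_mem (f a) (f b)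
  omega

theorem BehavesLikeId.compSign_eq {f : P → P} {X : Set P} (hf : f.Injective)
    (h : BehavesLikeId f X) {a b : P} (ha : a ∈ X) (hb : b ∈ X) :
    compSign (f a) (f b) = compSign a b := by
  rcases eq_or_ne a b with rfl | hab
  · simp only [compSign_self]
  have h₁ := (h a ha b hb).1
  have h₂ := (h a ha b hb).2
  have h₃ := (h b hb a ha).1
  rw [← compSign_eq_one_iff, ← compSign_eq_one_iff] at h₁
  rw [← compSign_eq_zero_iff hab, ← compSign_eq_zero_iff (hf.ne hab)] at h₂
  rw [← compSign_eq_neg_one_iff, ← compSign_eq_neg_one_iff] at h₃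
  have := compSign_mem a b
  omega

theorem behavesLikeId_of_compSign_eq {f : P → P} {X : Set P} (hf : f.Injective)
    (h : ∀ a ∈ X, ∀ b ∈ X, compSign (f a) (f b) = compSign a b) : BehavesLikeId f X := by
  refine fun a ha b hb => ⟨fun hlt => ?_, fun hp => ?_⟩
  · rw [← compSign_eq_one_iff, h a ha b hb, compSign_eq_one_iff]
    exact hlt
  · have hab : a ≠ b := fun e => hp.1 e.le
    rw [← compSign_eq_zero_iff (hf.ne hab), h a ha b hb, compSign_eq_zero_iff hab]
    exact hp

/-- Between consecutive pieces a rotation lowers the comparison sign by one. -/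
theorem compSign_eq_sub_one {f : P → P} (hf : f.Injective) {a b : P} (hab : a ≠ b)
    (hba : ¬ b < a) (h : (f b < f a ↔ Perp a b) ∧ (Perp (f a) (f b) ↔ a < b)) :
    compSign (f a) (f b) = compSign a b - 1 := by
  rw [← compSign_eq_neg_one_iff, ← compSign_eq_zero_iff hab,
    ← compSign_eq_zero_iff (hf.ne hab), ← compSign_eq_one_iff] at h
  rw [← compSign_eq_neg_one_iff] at hba
  have := compSign_mem a b
  omega

theorem IsRotation.exists_shiftsBy {f : Equiv.Perm P} (h : IsRotation f) :
    ∃ l : P → ℤ, ShiftsBy f l := by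
  classical
  obtain ⟨X, Y, Z, hcov, hXY, hXZ, hYZ, hX, hZ, hlt, hfX, hfY, hfZ, hfXZ, hfXY, hfYZ⟩ := h
  rw [Set.disjoint_left] at hXY hXZ hYZ
  have hinj := f.injective
  have eXY : ∀ x ∈ X, ∀ y ∈ Y, compSign (f x) (f y) = compSign x y - 1 := fun x hx y hy =>
    compSign_eq_sub_one hinj (fun e => hXY hx (e ▸ hy)) (fun e => hXY (hX e.le hx) hy)
      (hfXY x hx y hy)
  have eYZ : ∀ y ∈ Y, ∀ z ∈ Z, compSign (f y) (f z) = compSign y z - 1 := fun y hy z hz =>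
    compSign_eq_sub_one hinj (fun e => hYZ hy (e ▸ hz)) (fun e => hYZ hy (hZ e.le hz))
      (hfYZ y hy z hz)
  have eXZ : ∀ x ∈ X, ∀ z ∈ Z, compSign (f x) (f z) = compSign x z - 2 := fun x hx z hz => by
    rw [compSign_eq_one_iff.2 (hlt x hx z hz), compSign_eq_neg_one_iff.2 (hfXZ x hx z hz)]
    rfl
  let l : P → ℤ := fun p => if p ∈ X then 0 else if p ∈ Y then 1 else 2
  have lX : ∀ p ∈ X, l p = 0 := fun p hp => if_pos hp
  have lY : ∀ p ∈ Y, l p = 1 := fun p hp => by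
    simp only [l, if_neg (fun h => hXY h hp), if_pos hp]
  have lZ : ∀ p ∈ Z, l p = 2 := fun p hp => by
    simp only [l, if_neg (fun h => hXZ h hp), if_neg (fun h => hYZ h hp)]
  refine ⟨l, fun a b => ?_⟩
  have s := compSign_swap a b
  have t := compSign_swap (f a) (f b)
  rcases hcov a with ha | ha | ha <;> rcases hcov b with hb | hb | hb
  · rw [lX a ha, lX b hb, hfX.compSign_eq hinj ha hb]; ring
  · rw [lX a ha, lY b hb, eXY a ha b hb]; ring
  · rw [lX a ha, lZ b hb, eXZ a ha b hb]; ring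
  · have := eXY b hb a ha
    rw [lY a ha, lX b hb]; omega
  · rw [lY a ha, lY b hb, hfY.compSign_eq hinj ha hb]; ring
  · rw [lY a ha, lZ b hb, eYZ a ha b hb]; ring
  · have := eXZ b hb a ha
    rw [lZ a ha, lX b hb]; omega
  · have := eYZ b hb a ha
    rw [lZ a ha, lY b hb]; omega
  · rw [lZ a ha, lZ b hb, hfZ.compSign_eq hinj ha hb]; ring

theorem ShiftsBy.isRotation_of_mem_window {f : Equiv.Perm P} {l : P → ℤ} (h : ShiftsBy f l)
    {k : ℤ} (hk : ∀ p, k ≤ l p ∧ l p ≤ k + 2) : IsRotation f := by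
  have hstep : ∀ a b, l b = l a + 1 →
      (f b < f a ↔ Perp a b) ∧ (Perp (f a) (f b) ↔ a < b) := fun a b e => by
    have hab : a ≠ b := by rintro rfl; omega
    rw [← compSign_eq_neg_one_iff, ← compSign_eq_zero_iff hab,
      ← compSign_eq_zero_iff (f.injective.ne hab), ← compSign_eq_one_iff]
    have := h a b
    omega
  have hmono : ∀ a b, a ≤ b → l a ≤ l b := fun a b hab => by
    rcases hab.eq_or_lt with rfl | hab
    · exact le_rfl
    have h₁ := h a b
    have h₂ := compSign_mem (f a) (f b)
    rw [compSign_eq_one_iff.2 hab] at h₁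
    omega
  have hlevel : ∀ j, BehavesLikeId f {p | l p = j} := fun j =>
    behavesLikeId_of_compSign_eq f.injective fun a ha b hb => by
      have := h a b
      simp only [Set.mem_ofPred_eq] at ha hb
      omega
  have hdisj : ∀ i j, i ≠ j → Disjoint {p | l p = i} {p | l p = j} := fun i j hij =>
    Set.disjoint_left.2 fun p hi hj => hij (hi.symm.trans hj)
  refine ⟨{p | l p = k}, {p | l p = k + 1}, {p | l p = k + 2}, fun p => ?_,
    hdisj _ _ (by omega), hdisj _ _ (by omega), hdisj _ _ (by omega),
    fun a b hab ha => ?_, fun a b hab ha => ?_, fun x hx z hz => ?_,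
    hlevel _, hlevel _, hlevel _, fun x hx z hz => ?_,
    fun x hx y hy => hstep x y ?_, fun y hy z hz => hstep y z ?_⟩ <;>
    simp only [Set.mem_ofPred_eq] at *
  · have := hk p
    omega
  · have := hmono _ _ hab
    have := hk b
    omega
  · have := hmono _ _ hab
    have := hk b
    omega
  · rw [← compSign_eq_one_iff]
    have := h x z
    have := compSign_mem x z
    have := compSign_mem (f x) (f z)
    omega
  · rw [← compSign_eq_neg_one_iff]
    have := h x z
    have := compSign_mem x z
    have := compSign_mem (f x) (f z)
    omega
  · omega
  · omega

theorem ShiftsBy.isRotation [Nonempty P] {f : Equiv.Perm P} {l : P → ℤ} (h : ShiftsBy f l) :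
    IsRotation f := by
  obtain ⟨p₀⟩ := ‹Nonempty P›
  obtain ⟨k, ⟨q, rfl⟩, hmin⟩ := Int.exists_least_of_bdd (P := fun k => ∃ q, l q = k)
    ⟨l p₀ - 2, by rintro _ ⟨q, rfl⟩; have := h.sub_le_two p₀ q; omega⟩ ⟨_, p₀, rfl⟩
  exact h.isRotation_of_mem_window fun p =>
    ⟨hmin _ ⟨p, rfl⟩, by have := h.sub_le_two p q; omega⟩

/-- The composition of two rotations of `P` is again a rotation of `P`. -/
theorem rotation_comp [Countable P] [Infinite P]
    (hU : IsUniversal P) (hH : IsHomogeneous P)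
    (f g : Equiv.Perm P) (hf : IsRotation f) (hg : IsRotation g) :
    IsRotation (f * g) := by
  obtain ⟨l, hl⟩ := hf.exists_shiftsBy
  obtain ⟨m, hm⟩ := hg.exists_shiftsBy
  exact (hl.mul hm).isRotation
end

section
/- A permutation f of P preserves each of the three ternary relations Pari, Cyc and Cyc' if and only if f is a rotation of P. -/
variable {P : Type} [PartialOrder P]

open Classical in
/-- The order of `P` as an antisymmetric function to `ℤ/3`: `1` on `a < b`, `-1` on `b < a`. -/
noncomputable def orderSign (a b : P) : ZMod 3 :=
  if a < b then 1 else if b < a then -1 else 0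

lemma orderSign_cases (a b : P) :
    (a < b ∧ orderSign a b = 1) ∨ (b < a ∧ orderSign a b = -1) ∨
      (a = b ∧ orderSign a b = 0) ∨ (Perp a b ∧ orderSign a b = 0) := by
  unfold orderSign Perp
  by_cases h₁ : a < b
  · simp [h₁]
  by_cases h₂ : b < a
  · simp [h₁, h₂]
  by_cases h₃ : a = b
  · simp [h₃]
  · have h₄ : ¬ a ≤ b := fun h => h₁ (lt_of_le_of_ne h h₃)
    have h₅ : ¬ b ≤ a := fun h => h₂ (lt_of_le_of_ne h (Ne.symm h₃))
    simp [h₁, h₂, h₄, h₅]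

lemma orderSign_eq_one {a b : P} : orderSign a b = 1 ↔ a < b := by
  unfold orderSign
  split_ifs with h₁ h₂
  · simp [h₁]
  · simp only [h₁, iff_false]; decide
  · simp only [h₁, iff_false]; decide

lemma orderSign_swap (a b : P) : orderSign b a = -orderSign a b := by
  unfold orderSign
  split_ifs with h₁ h₂ h₂
  · exact absurd h₁ h₂.asymm
  all_goals simp

lemma orderSign_eq_neg_one {a b : P} : orderSign a b = -1 ↔ b < a := by
  rw [orderSign_swap, neg_inj, orderSign_eq_one]

lemma Perp.ne {a b : P} (h : Perp a b) : a ≠ b := fun e => h.1 e.le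

lemma Perp.symm {a b : P} (h : Perp a b) : Perp b a := ⟨h.2, h.1⟩

lemma orderSign_eq_zero {a b : P} (hab : a ≠ b) : orderSign a b = 0 ↔ Perp a b := by
  have h10 : (1 : ZMod 3) ≠ 0 := by decide
  have h20 : (-1 : ZMod 3) ≠ 0 := by decide
  rcases orderSign_cases a b with h | h | h | h
  · simp [h.2, h10, Perp, h.1.le]
  · simp [h.2, Perp, h.1.le]
  · exact absurd h.1 hab
  · simp [h.2, h.1]

lemma orderSign_self (a : P) : orderSign a a = 0 := by
  simp [orderSign]

/-- The sum of `orderSign` around a triple, i.e. the coboundary of `orderSign`. -/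
noncomputable def tripleSign (a b c : P) : ZMod 3 :=
  orderSign a b + orderSign b c + orderSign c a

/-- The values `orderSign` can take around a triple, as allowed by transitivity. -/
def TransSigns (p q s : ZMod 3) : Prop :=
  (p = q → p ≠ 0 → s = -p) ∧ (q = s → q ≠ 0 → p = -q) ∧ (s = p → s ≠ 0 → q = -s)

instance (p q s : ZMod 3) : Decidable (TransSigns p q s) := by
  unfold TransSigns; infer_instance

lemma orderSign_trans {a b c : P} (h : orderSign a b = orderSign b c)
    (h₀ : orderSign a b ≠ 0) : orderSign c a = -orderSign a b := by
  rcases orderSign_cases a b with h₁ | h₁ | h₁ | h₁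
  · have h₂ : b < c := orderSign_eq_one.1 (h ▸ h₁.2)
    rw [h₁.2, orderSign_eq_neg_one]
    exact h₁.1.trans h₂
  · have h₂ : c < b := orderSign_eq_neg_one.1 (h ▸ h₁.2)
    rw [h₁.2, neg_neg, orderSign_eq_one]
    exact h₂.trans h₁.1
  · exact absurd h₁.2 h₀
  · exact absurd h₁.2 h₀

lemma transSigns (a b c : P) :
    TransSigns (orderSign a b) (orderSign b c) (orderSign c a) :=
  ⟨orderSign_trans, orderSign_trans, orderSign_trans⟩

lemma tripleSign_ne {a b c : P} (h : tripleSign a b c ≠ 0) : a ≠ b ∧ b ≠ c ∧ c ≠ a := by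
  refine ⟨?_, ?_, ?_⟩ <;> rintro rfl <;> apply h <;> rw [tripleSign, orderSign_self]
  · rw [orderSign_swap a c]; ring
  · rw [orderSign_swap a b]; ring
  · rw [orderSign_swap c b]; ring

lemma Cyc.ne {a b c : P} (h : Cyc a b c) : a ≠ b ∧ b ≠ c ∧ c ≠ a := by
  rcases h with h | h | h | h | h | h
  · exact ⟨h.1.ne, h.2.ne, (h.1.trans h.2).ne'⟩
  · exact ⟨(h.1.trans h.2).ne', h.1.ne, h.2.ne⟩
  · exact ⟨h.2.ne, (h.1.trans h.2).ne', h.1.ne⟩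
  · exact ⟨h.1.ne, h.2.2.ne.symm, h.2.1.ne⟩
  · exact ⟨h.2.1.ne, h.1.ne, h.2.2.ne.symm⟩
  · exact ⟨h.2.1.ne.symm, h.2.2.ne, h.1.ne⟩

lemma tripleSign_eq_one_iff {a b c : P} : tripleSign a b c = 1 ↔ Cyc a b c := by
  have key : ∀ p q s : ZMod 3, TransSigns p q s → (p + q + s = 1 ↔
      (p = 1 ∧ q = 1) ∨ (q = 1 ∧ s = 1) ∨ (s = 1 ∧ p = 1) ∨ (p = 1 ∧ s = 0 ∧ q = 0) ∨
      (q = 1 ∧ p = 0 ∧ s = 0) ∨ (s = 1 ∧ p = 0 ∧ q = 0)) := by decide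
  have h10 : (1 : ZMod 3) ≠ 0 := by decide
  by_cases hne : a ≠ b ∧ b ≠ c ∧ c ≠ a
  · have comm : ∀ x y : P, Perp x y ↔ Perp y x := fun x y => ⟨Perp.symm, Perp.symm⟩
    rw [tripleSign, key _ _ _ (transSigns a b c)]
    simp only [orderSign_eq_one, orderSign_eq_zero hne.1, orderSign_eq_zero hne.2.1,
      orderSign_eq_zero hne.2.2, Cyc, comm c b, comm a c, comm b a]
  · exact ⟨fun h => absurd (tripleSign_ne (h ▸ h10)) hne, fun h => absurd h.ne hne⟩

lemma tripleSign_reverse (a b c : P) : tripleSign c b a = -tripleSign a b c := by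
  rw [tripleSign, tripleSign, orderSign_swap b c, orderSign_swap a b, orderSign_swap c a]
  ring

lemma tripleSign_eq_neg_one_iff {a b c : P} : tripleSign a b c = -1 ↔ Cyc' a b c := by
  rw [Cyc', ← tripleSign_eq_one_iff, tripleSign_reverse a b c, neg_eq_iff_eq_neg]

lemma tripleSign_eq_zero_iff {a b c : P} (hab : a ≠ b) (hbc : b ≠ c) (hca : c ≠ a) :
    tripleSign a b c = 0 ↔ Pari a b c := by
  have key : ∀ p q s : ZMod 3, TransSigns p q s → (p + q + s = 0 ↔
      (p = 0 ∧ q = 0 ∧ s = 0) ∨ (p = 1 ∧ s = -1 ∧ q = 0) ∨ (p = -1 ∧ q = 1 ∧ s = 0) ∨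
      (s = 1 ∧ q = -1 ∧ p = 0) ∨ (p = -1 ∧ s = 1 ∧ q = 0) ∨ (p = 1 ∧ q = -1 ∧ s = 0) ∨
      (s = -1 ∧ q = 1 ∧ p = 0)) := by
    unfold TransSigns
    decide
  have comm : Perp c a ↔ Perp a c := ⟨Perp.symm, Perp.symm⟩
  rw [tripleSign, key _ _ _ (transSigns a b c)]
  simp only [orderSign_eq_one, orderSign_eq_neg_one, orderSign_eq_zero hab,
    orderSign_eq_zero hbc, orderSign_eq_zero hca, Pari, comm]

lemma Pari.ne {a b c : P} (h : Pari a b c) : a ≠ b ∧ b ≠ c ∧ c ≠ a := by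
  rcases h with h | h | h | h | h | h | h
  · exact ⟨h.1.ne, h.2.1.ne, h.2.2.ne.symm⟩
  · exact ⟨h.1.ne, h.2.2.ne, h.2.1.ne'⟩
  · exact ⟨h.1.ne', h.2.1.ne, h.2.2.ne.symm⟩
  · exact ⟨h.2.2.ne, h.2.1.ne', h.1.ne⟩
  · exact ⟨h.1.ne', h.2.2.ne, h.2.1.ne⟩
  · exact ⟨h.1.ne, h.2.1.ne', h.2.2.ne.symm⟩
  · exact ⟨h.2.2.ne, h.2.1.ne, h.1.ne'⟩

lemma pari_iff {a b c : P} :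
    Pari a b c ↔ (a ≠ b ∧ b ≠ c ∧ c ≠ a) ∧ tripleSign a b c = 0 :=
  ⟨fun h => ⟨h.ne, (tripleSign_eq_zero_iff h.ne.1 h.ne.2.1 h.ne.2.2).2 h⟩,
    fun h => (tripleSign_eq_zero_iff h.1.1 h.1.2.1 h.1.2.2).1 h.2⟩

lemma preserves_iff_tripleSign (f : Equiv.Perm P) :
    (Preserves3 (⇑f) Pari ∧ Preserves3 (⇑f) Cyc ∧ Preserves3 (⇑f) Cyc') ↔
      ∀ a b c : P, tripleSign (f a) (f b) (f c) = tripleSign a b c := by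
  constructor
  · rintro ⟨-, h₁, h₂⟩ a b c
    have e₁ := h₁ a b c
    have e₂ := h₂ a b c
    rw [← tripleSign_eq_one_iff, ← tripleSign_eq_one_iff] at e₁
    rw [← tripleSign_eq_neg_one_iff, ← tripleSign_eq_neg_one_iff] at e₂
    revert e₁ e₂
    generalize tripleSign a b c = p
    generalize tripleSign (f a) (f b) (f c) = q
    revert p q
    decide
  · intro h
    refine ⟨fun a b c => ?_, fun a b c => ?_, fun a b c => ?_⟩
    · simp only [pari_iff, h, ne_eq, f.injective.eq_iff]
    · rw [← tripleSign_eq_one_iff, ← tripleSign_eq_one_iff, h]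
    · rw [← tripleSign_eq_neg_one_iff, ← tripleSign_eq_neg_one_iff, h]

/-- `f` changes `orderSign` by the coboundary of `g`. -/
def TwistedBy (f : Equiv.Perm P) (g : P → ZMod 3) : Prop :=
  ∀ a b : P, orderSign (f a) (f b) = orderSign a b + (g b - g a)

lemma tripleSign_iff_exists_twistedBy [Nonempty P] (f : Equiv.Perm P) :
    (∀ a b c : P, tripleSign (f a) (f b) (f c) = tripleSign a b c) ↔
      ∃ g : P → ZMod 3, TwistedBy f g := by
  constructor
  · intro h
    obtain ⟨o⟩ := ‹Nonempty P›
    refine ⟨fun a => orderSign (f o) (f a) - orderSign o a, fun a b => ?_⟩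
    have e := h o a b
    rw [tripleSign, tripleSign, orderSign_swap o b, orderSign_swap (f o) (f b)] at e
    linear_combination e
  · rintro ⟨g, h⟩ a b c
    rw [tripleSign, tripleSign, h, h, h]
    ring

lemma isRotation_iff (f : Equiv.Perm P) :
    IsRotation f ↔ ∃ g : P → ZMod 3, TwistedBy f g ∧ IsLowerSet {p | g p = 1} ∧
      IsUpperSet {p | g p = -1} ∧ ∀ x z, g x = 1 → g z = -1 → x < z := by
  classical
  have h3 : ∀ k : ZMod 3, k = 1 ∨ k = 0 ∨ k = -1 := by decide
  have h10 : (1 : ZMod 3) ≠ 0 := by decide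
  have h12 : (1 : ZMod 3) ≠ -1 := by decide
  have h02 : (0 : ZMod 3) ≠ -1 := by decide
  constructor
  · rintro ⟨X, Y, Z, hcov, hXY, hXZ, hYZ, hX, hZ, hlt, idX, idY, idZ, tXZ, tXY, tYZ⟩
    rw [Set.disjoint_left] at hXY hXZ hYZ
    let g : P → ZMod 3 := fun p => if p ∈ X then 1 else if p ∈ Y then 0 else -1
    have gX : ∀ p, g p = 1 ↔ p ∈ X := by
      intro p
      by_cases hx : p ∈ X
      · simp [g, hx]
      · by_cases hy : p ∈ Y
        · simp [g, hx, hy]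
        · simp [g, hx, hy, h12.symm]
    have gY : ∀ p, p ∈ Y → g p = 0 := by
      intro p hy
      have hx : p ∉ X := fun hx => hXY hx hy
      simp [g, hx, hy]
    have gZ : ∀ p, g p = -1 ↔ p ∈ Z := by
      intro p
      rcases hcov p with hx | hy | hz
      · simp [(gX p).2 hx, h12, hXZ hx]
      · simp [gY p hy, h02, hYZ hy]
      · have hx : p ∉ X := fun hx => hXZ hx hz
        have hy : p ∉ Y := fun hy => hYZ hy hz
        simp [g, hx, hy, hz]
    have idl : ∀ W : Set P, BehavesLikeId (⇑f) W → ∀ a ∈ W, ∀ b ∈ W,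
        orderSign (f a) (f b) = orderSign a b := by
      intro W hW a ha b hb
      rcases orderSign_cases a b with h | h | h | h <;> rw [h.2]
      · exact orderSign_eq_one.2 ((hW a ha b hb).1 h.1)
      · exact orderSign_eq_neg_one.2 ((hW b hb a ha).1 h.1)
      · rw [h.1, orderSign_self]
      · have h' := (hW a ha b hb).2 h.1
        exact (orderSign_eq_zero h'.ne).2 h'
    have eXZ : ∀ a ∈ X, ∀ b ∈ Z, orderSign (f a) (f b) = orderSign a b + 1 := by
      intro a ha b hb
      rw [orderSign_eq_one.2 (hlt a ha b hb), orderSign_eq_neg_one.2 (tXZ a ha b hb)]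
      decide
    have shift : ∀ a b : P, a ≠ b → ¬ b < a → (f b < f a ↔ Perp a b) →
        (Perp (f a) (f b) ↔ a < b) → orderSign (f a) (f b) = orderSign a b - 1 := by
      intro a b hne hba h₁ h₂
      rcases orderSign_cases a b with h | h | h | h
      · have h' := h₂.2 h.1
        rw [h.2, (orderSign_eq_zero h'.ne).2 h', sub_self]
      · exact absurd h.1 hba
      · exact absurd h.1 hne
      · rw [h.2, orderSign_eq_neg_one.2 (h₁.2 h.1), zero_sub]
    have eXY : ∀ a ∈ X, ∀ b ∈ Y, orderSign (f a) (f b) = orderSign a b - 1 :=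
      fun a ha b hb => shift a b (fun e => hXY ha (e ▸ hb))
        (fun h => hXY (hX h.le ha) hb) (tXY a ha b hb).1 (tXY a ha b hb).2
    have eYZ : ∀ a ∈ Y, ∀ b ∈ Z, orderSign (f a) (f b) = orderSign a b - 1 :=
      fun a ha b hb => shift a b (fun e => hYZ ha (e ▸ hb))
        (fun h => hYZ ha (hZ h.le hb)) (tYZ a ha b hb).1 (tYZ a ha b hb).2
    have h111 : (1 : ZMod 3) = -1 - 1 := by decide
    refine ⟨g, fun a b => ?_, ?_, ?_, ?_⟩
    · rcases hcov a with ha | ha | ha <;> rcases hcov b with hb | hb | hb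
      · rw [idl X idX a ha b hb, (gX a).2 ha, (gX b).2 hb]; ring
      · rw [eXY a ha b hb, (gX a).2 ha, gY b hb]; ring
      · rw [eXZ a ha b hb, (gX a).2 ha, (gZ b).2 hb, ← h111]
      · rw [orderSign_swap, eXY b hb a ha, orderSign_swap a b, gY a ha, (gX b).2 hb]; ring
      · rw [idl Y idY a ha b hb, gY a ha, gY b hb]; ring
      · rw [eYZ a ha b hb, gY a ha, (gZ b).2 hb]; ring
      · rw [orderSign_swap, eXZ b hb a ha, orderSign_swap a b, (gZ a).2 ha, (gX b).2 hb]
        linear_combination -h111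
      · rw [orderSign_swap, eYZ b hb a ha, orderSign_swap a b, (gZ a).2 ha, gY b hb]; ring
      · rw [idl Z idZ a ha b hb, (gZ a).2 ha, (gZ b).2 hb]; ring
    · simpa only [gX, Set.ofPred_mem_eq] using hX
    · simpa only [gZ, Set.ofPred_mem_eq] using hZ
    · exact fun x z hx hz => hlt x ((gX x).1 hx) z ((gZ z).1 hz)
  · rintro ⟨g, hg, hX, hZ, hlt⟩
    have idl : ∀ k, BehavesLikeId (⇑f) {p | g p = k} := by
      intro k a ha b hb
      have e := hg a b
      rw [show g a = k from ha, show g b = k from hb, sub_self, add_zero] at e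
      refine ⟨fun h => ?_, fun h => ?_⟩
      · rwa [← orderSign_eq_one, e, orderSign_eq_one]
      · rwa [← orderSign_eq_zero (f.injective.ne h.ne), e, orderSign_eq_zero h.ne]
    have shift : ∀ a b : P, g b - g a = -1 →
        (f b < f a ↔ Perp a b) ∧ (Perp (f a) (f b) ↔ a < b) := by
      intro a b h
      have hne : a ≠ b := by
        rintro rfl
        rw [sub_self] at h
        exact h02 h
      rw [← orderSign_eq_neg_one, ← orderSign_eq_zero hne, ← orderSign_eq_one,
        ← orderSign_eq_zero (f.injective.ne hne), hg, h]
      generalize orderSign a b = p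
      revert p
      decide
    refine ⟨{p | g p = 1}, {p | g p = 0}, {p | g p = -1}, fun p => h3 (g p), ?_, ?_, ?_,
      hX, hZ, fun x hx z hz => hlt x z hx hz, idl 1, idl 0, idl (-1), ?_, ?_, ?_⟩
    · exact Set.disjoint_left.2 fun p h h' => h10 (h.symm.trans h')
    · exact Set.disjoint_left.2 fun p h h' => h12 (h.symm.trans h')
    · exact Set.disjoint_left.2 fun p h h' => h02 (h.symm.trans h')
    · intro x hx z hz
      rw [← orderSign_eq_neg_one, hg, orderSign_eq_one.2 (hlt x z hx hz),
        show g x = 1 from hx, show g z = -1 from hz]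
      decide
    · exact fun x hx y hy =>
        shift x y (by rw [show g x = 1 from hx, show g y = 0 from hy]; decide)
    · exact fun y hy z hz =>
        shift y z (by rw [show g y = 0 from hy, show g z = -1 from hz]; decide)

lemma TwistedBy.add_const {f : Equiv.Perm P} {g : P → ZMod 3} (h : TwistedBy f g)
    (k : ZMod 3) : TwistedBy f (fun p => g p + k) := by
  intro a b
  rw [h, add_sub_add_right_eq_sub]

lemma TwistedBy.transSigns_add {f : Equiv.Perm P} {g : P → ZMod 3} (h : TwistedBy f g)
    (a b c : P) :
    TransSigns (orderSign a b + (g b - g a)) (orderSign b c + (g c - g b))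
      (orderSign c a + (g a - g c)) := by
  rw [← h, ← h, ← h]
  exact transSigns _ _ _

/-- A single pair `a < b` along which the twist increases by one pins down the twist. -/
lemma TwistedBy.of_lt {f : Equiv.Perm P} {g : P → ZMod 3} (h : TwistedBy f g) {a b : P}
    (hab : a < b) (hg : g b = g a + 1) (c : P) :
    (g c = g a → c < b) ∧ (g c = g b → a < c) ∧ (c < a → g c = g a) ∧
      (b < c → g c = g b) := by
  have t := transSigns a b c
  have t' := h.transSigns_add a b c
  have swap : c < b ↔ orderSign b c = -1 := orderSign_eq_neg_one.symm
  have swap' : a < c ↔ orderSign c a = -1 := orderSign_eq_neg_one.symm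
  rw [swap, swap', ← orderSign_eq_one, ← orderSign_eq_one]
  rw [orderSign_eq_one.2 hab] at t t'
  rw [hg] at t' ⊢
  revert t t'
  generalize orderSign b c = q
  generalize orderSign c a = s
  generalize g a = u
  generalize g c = v
  revert q s u v
  decide

/-- If the twist never increases by one along `<`, it takes at most two values. -/
lemma TwistedBy.not_all_values {f : Equiv.Perm P} {g : P → ZMod 3} (h : TwistedBy f g)
    (hg : ∀ a b : P, a < b → g b ≠ g a + 1) : ∃ k, ∀ p, g p ≠ k := by
  by_contra! hall
  obtain ⟨a, ha⟩ := hall 1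
  obtain ⟨b, hb⟩ := hall 0
  obtain ⟨c, hc⟩ := hall (-1)
  have hab := hg b a
  have hbc := hg c b
  have hca := hg a c
  have t := transSigns a b c
  have t' := h.transSigns_add a b c
  rw [← orderSign_eq_neg_one] at hab hbc hca
  rw [ha, hb] at hab
  rw [hb, hc] at hbc
  rw [ha, hc] at hca
  rw [ha, hb, hc] at t'
  revert t t' hab hbc hca
  generalize orderSign a b = p
  generalize orderSign b c = q
  generalize orderSign c a = s
  revert p q s
  decide

lemma isRotation_iff_exists_twistedBy (f : Equiv.Perm P) :
    IsRotation f ↔ ∃ g : P → ZMod 3, TwistedBy f g := by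
  rw [isRotation_iff]
  refine ⟨fun ⟨g, hg, _⟩ => ⟨g, hg⟩, fun ⟨g, hg⟩ => ?_⟩
  by_cases hup : ∃ a b : P, a < b ∧ g b = g a + 1
  · obtain ⟨a, b, hab, hgab⟩ := hup
    have hb : g b + (1 - g a) = -1 := by
      rw [hgab]
      generalize g a = u
      revert u
      decide
    have eqa : ∀ p, g p + (1 - g a) = 1 ↔ g p = g a := fun p =>
      ⟨fun e => by linear_combination e, fun e => by linear_combination e⟩
    have eqb : ∀ p, g p + (1 - g a) = -1 ↔ g p = g b := fun p =>
      ⟨fun e => by linear_combination e - hb, fun e => by linear_combination e + hb⟩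
    refine ⟨_, hg.add_const (1 - g a), ?_, ?_, ?_⟩
    all_goals simp only [eqa, eqb]
    · intro x y hyx hx
      rcases hyx.lt_or_eq with hlt | rfl
      · have hx' : g x = g a := hx
        exact ((hg.of_lt ((hg.of_lt hab hgab x).1 hx') (hx' ▸ hgab) y).2.2.1 hlt).trans hx'
      · exact hx
    · intro z y hzy hz
      rcases hzy.lt_or_eq with hlt | rfl
      · have hz' : g z = g b := hz
        exact ((hg.of_lt ((hg.of_lt hab hgab z).2.1 hz') (hz'.trans hgab) y).2.2.2 hlt).trans hz'
      · exact hz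
    · intro x z hx hz
      exact (hg.of_lt ((hg.of_lt hab hgab x).1 hx) (hx ▸ hgab) z).2.1 hz
  · push Not at hup
    obtain ⟨k, hk⟩ := hg.not_all_values hup
    have hZ : ∀ p, g p + (-1 - k) ≠ -1 := fun p e => hk p (by linear_combination e)
    refine ⟨_, hg.add_const (-1 - k), ?_, ?_, fun x z _ hz => absurd hz (hZ z)⟩
    · intro x y hyx hx
      rcases hyx.lt_or_eq with hlt | rfl
      · have h₁ := hup y x hlt
        have h₂ := hk y
        have h₃ : g x + (-1 - k) = 1 := hx
        change g y + (-1 - k) = 1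
        clear hk hZ hx
        revert h₁ h₂ h₃
        generalize g x = u
        generalize g y = v
        revert u v k
        decide
      · exact hx
    · exact fun z y _ hz => absurd hz (hZ z)

/-- A permutation preserves `Pari`, `Cyc` and `Cyc'` iff it is a rotation. -/
theorem preserves_all_three_iff_rotation [Countable P] [Infinite P]
    (hU : IsUniversal P) (hH : IsHomogeneous P) (f : Equiv.Perm P) :
    (Preserves3 (⇑f) Pari ∧ Preserves3 (⇑f) Cyc ∧ Preserves3 (⇑f) Cyc') ↔
      IsRotation f := by
  rw [preserves_iff_tripleSign, tripleSign_iff_exists_twistedBy,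
    isRotation_iff_exists_twistedBy]
end
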